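/- (Decomposition of ℋ_k under SO(m) × Sp(2n).) For every integer k ≥ 0, the space ℋ_k is the internal direct sum ℋ_k = ⊕_{i=0}^{min(n,k)} ℋ^b_{k−i}·ℋ^f_i ⊕ ⊕_{j=0}^{min(n,k−1)−1} ⊕_{l=1}^{min(n−j, ⌊(k−j)/2⌋)} f_{l,k−2l−j,j}·(ℋ^b_{k−2l−j}·ℋ^f_j). Moreover, each summand is invariant under the action of SO(m) × Sp(2n) on 𝒫 and is irreducible as an SO(m) × Sp(2n)-module (its only invariant subspaces are 0 and itself). -/

import Mathlib

set_option synthInstance.maxHeartbeats 1000000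
set_option maxHeartbeats 1000000
open scoped TensorProduct
open MvPolynomial Matrix

noncomputable section

variable (m n : ℕ)

/-- The Grassmann algebra Λ_{2n} on `2n` anticommuting generators. -/
abbrev Grass (n : ℕ) := ExteriorAlgebra ℝ (Fin (2*n) → ℝ)

/-- The algebra of super-polynomials 𝒫 = ℝ[x_1,…,x_m] ⊗ Λ_{2n}. -/
abbrev SuperPoly (m n : ℕ) := MvPolynomial (Fin m) ℝ ⊗[ℝ] Grass n

/-- The fermionic generator x`_i. -/
def fgen (i : Fin (2*n)) : Grass n :=
  ExteriorAlgebra.ι ℝ (Pi.single i (1:ℝ))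

/-- The fermionic partial derivative ∂_{x`_i}, the odd derivation with
∂_{x`_i}(x`_j) = δ_{ij}: contraction with the i-th dual basis vector. -/
def fpderiv (i : Fin (2*n)) : Grass n →ₗ[ℝ] Grass n :=
  CliffordAlgebra.contractLeft (LinearMap.proj i)

/-- The fermionic Laplace operator on Λ_{2n}. -/
def lapF : Grass n →ₗ[ℝ] Grass n :=
  (4:ℝ) • ∑ j : Fin n,
    (fpderiv n ⟨2*j.1, by omega⟩) ∘ₗ (fpderiv n ⟨2*j.1+1, by omega⟩)

/-- The bosonic Laplace operator Δ_b = −∑ ∂_{x_j}² on ℝ[x_1,…,x_m]. -/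
def lapB : MvPolynomial (Fin m) ℝ →ₗ[ℝ] MvPolynomial (Fin m) ℝ :=
  - ∑ j : Fin m, (pderiv j).toLinearMap ∘ₗ (pderiv j).toLinearMap

/-- The super Laplace operator Δ = Δ_b + Δ_f on 𝒫. -/
def lap : SuperPoly m n →ₗ[ℝ] SuperPoly m n :=
  LinearMap.rTensor (Grass n) (lapB m) + LinearMap.lTensor (MvPolynomial (Fin m) ℝ) (lapF n)

/-- x̲² = −∑ x_j². -/
def rb2 : MvPolynomial (Fin m) ℝ := - ∑ j : Fin m, (X j)^2

/-- x`² = ∑_{j=1}^n x`_{2j−1} x`_{2j}. -/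
def rf2 : Grass n := ∑ j : Fin n, fgen n ⟨2*j.1, by omega⟩ * fgen n ⟨2*j.1+1, by omega⟩

/-- The generalized norm squared x² = x̲² + x`² as an element of 𝒫. -/
def r2 : SuperPoly m n := (rb2 m) ⊗ₜ 1 + 1 ⊗ₜ (rf2 n)

/-- The grade-`i` part of the Grassmann algebra. -/
def fgrade (i : ℕ) : Submodule ℝ (Grass n) :=
  (LinearMap.range (ExteriorAlgebra.ι ℝ (M := Fin (2*n) → ℝ)))^i

/-- The space 𝒫_k of super-polynomials homogeneous of total degree k. -/
def P (k : ℕ) : Submodule ℝ (SuperPoly m n) :=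
  ⨆ i : Fin (k+1), Submodule.map₂ (TensorProduct.mk ℝ _ _)
    (homogeneousSubmodule (Fin m) ℝ (k - i.1)) (fgrade n i.1)

/-- The space ℋ_k of spherical harmonics of degree k. -/
def H (k : ℕ) : Submodule ℝ (SuperPoly m n) :=
  P m n k ⊓ LinearMap.ker (lap m n)

/-- The super-dimension M = m − 2n. -/
def sdim : ℤ := (m : ℤ) - 2*n

/-- ℋ^b_p: classical harmonic polynomials of degree p in x_1,…,x_m. -/
def Hb (p : ℕ) : Submodule ℝ (MvPolynomial (Fin m) ℝ) :=
  homogeneousSubmodule (Fin m) ℝ p ⊓ LinearMap.ker (lapB m)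

/-- ℋ^f_q: fermionic (symplectic) harmonics of degree q. -/
def Hf (q : ℕ) : Submodule ℝ (Grass n) :=
  fgrade n q ⊓ LinearMap.ker (lapF n)

/-- ℋ^b_p · ℋ^f_q: the span in 𝒫 of the products H^b H^f. -/
def HbHf (p q : ℕ) : Submodule ℝ (SuperPoly m n) :=
  Submodule.map₂ (TensorProduct.mk ℝ _ _) (Hb m p) (Hf n q)
/-- The polynomial f_{k,p,q} = ∑_{i=0}^k C(k,i)((n−q−i)!/Γ(m/2+p+k−i)) x̲^{2(k−i)} x`^{2i}. -/
def fkpq (m n k p q : ℕ) : SuperPoly m n :=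
  ∑ i ∈ Finset.range (k+1),
    ((Nat.choose k i : ℝ) * ((n - q - i).factorial : ℝ) /
        Real.Gamma ((m:ℝ)/2 + p + k - i)) • (((rb2 m)^(k-i)) ⊗ₜ[ℝ] ((rf2 n)^i))

/-- The 2n × 2n block-diagonal matrix with n diagonal blocks [[0, 1/2], [−1/2, 0]]. -/
def Jmat (n : ℕ) : Matrix (Fin (2*n)) (Fin (2*n)) ℝ := fun i j =>
  if j.1 = i.1 + 1 ∧ i.1 % 2 = 0 then 1/2
  else if i.1 = j.1 + 1 ∧ j.1 % 2 = 0 then -1/2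
  else 0

/-- A ∈ SO(m). -/
def isSO (m : ℕ) (A : Matrix (Fin m) (Fin m) ℝ) : Prop :=
  Aᵀ * A = 1 ∧ A.det = 1

/-- D ∈ Sp(2n). -/
def isSp (n : ℕ) (D : Matrix (Fin (2*n)) (Fin (2*n)) ℝ) : Prop :=
  Dᵀ * Jmat n * D = Jmat n

/-- The action of the pair (A, D) on 𝒫 by algebra automorphisms, via the linear
substitution of variables (x, x`) ↦ (A x, D x`). -/
def act (m n : ℕ) (A : Matrix (Fin m) (Fin m) ℝ) (D : Matrix (Fin (2*n)) (Fin (2*n)) ℝ) :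
    SuperPoly m n →ₐ[ℝ] SuperPoly m n :=
  Algebra.TensorProduct.map
    (aeval (fun j : Fin m => ∑ i : Fin m, A j i • (X i : MvPolynomial (Fin m) ℝ)))
    (ExteriorAlgebra.map (Matrix.toLin' D))

/-- The index type for the decomposition of ℋ_k:
the left part indexes the summands ℋ^b_{k−i}·ℋ^f_i, 0 ≤ i ≤ min(n,k); the right part
indexes the summands f_{l,k−2l−j,j}·(ℋ^b_{k−2l−j}·ℋ^f_j), 0 ≤ j ≤ min(n,k−1)−1,
1 ≤ l ≤ min(n−j, ⌊(k−j)/2⌋). -/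
def decompIdx (n k : ℕ) : Type :=
  (Fin (min n k + 1)) ⊕ ((j : Fin (min n (k-1))) × Fin (min (n - j.1) ((k - j.1)/2)))

/-- The summands of the decomposition of ℋ_k. -/
def decompPiece (m n k : ℕ) : decompIdx n k → Submodule ℝ (SuperPoly m n)
  | .inl i => HbHf m n (k - i.1) i.1
  | .inr ⟨j, l⟩ =>
      Submodule.map (LinearMap.mulLeft ℝ (fkpq m n (l.1+1) (k - 2*(l.1+1) - j.1) j.1))
        (HbHf m n (k - 2*(l.1+1) - j.1) j.1)

section harmonics

variable {m n}

/-- A symmetric bilinear form with `B u u ≠ 0` for nonzero `u ∈ V` represents every functional on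
a finite-dimensional subspace `V`. -/
theorem exists_bilin_representative {M : Type*} [AddCommGroup M] [Module ℝ M]
    (B : M →ₗ[ℝ] M →ₗ[ℝ] ℝ) (V : Submodule ℝ M) [FiniteDimensional ℝ V]
    (hB : ∀ u ∈ V, B u u = 0 → u = 0) (φ : M →ₗ[ℝ] ℝ) :
    ∃ z ∈ V, ∀ u ∈ V, B z u = φ u := by
  let T : V →ₗ[ℝ] Module.Dual ℝ V := B.compl₁₂ V.subtype V.subtype
  have hT : Function.Injective T := by
    rw [← LinearMap.ker_eq_bot, LinearMap.ker_eq_bot']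
    intro u hu
    have h := congrArg (fun f => f u) hu
    exact Subtype.ext (hB u u.2 (by simpa [T] using h))
  have hs : Function.Surjective T :=
    (LinearMap.injective_iff_surjective_of_finrank_eq_finrank
      (Subspace.dual_finrank_eq (K := ℝ) (V := V)).symm).1 hT
  obtain ⟨z, hz⟩ := hs (φ ∘ₗ V.subtype)
  refine ⟨z, z.2, fun u hu => ?_⟩
  have h := congrArg (fun f => f ⟨u, hu⟩) hz
  simpa [T] using h

/-- Operators `x i`, `d i` satisfying mixed canonical (anti)commutation relations with signs `s`. -/
structure IsSuperWeyl {I M : Type*} [DecidableEq I] [AddCommGroup M] [Module ℝ M]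
    (s : I → I → ℝ) (x d : I → Module.End ℝ M) : Prop where
  dx : ∀ i j u, d i (x j u) = (if i = j then u else 0) + s i j • x j (d i u)
  dd : ∀ i j u, d i (d j u) = s i j • d j (d i u)

open Classical in
/-- The Fischer form on degree `k`, obtained by differentiating `k` times and pairing with
a fixed positive definite form. -/
def fischerForm {I M : Type*} [Fintype I] [AddCommGroup M] [Module ℝ M]
    (d : I → Module.End ℝ M) : ℕ → M →ₗ[ℝ] M →ₗ[ℝ] ℝ
  | 0 => (Module.Basis.ofVectorSpace ℝ M).toDual
  | k + 1 => ∑ i, (fischerForm d k).compl₁₂ (d i) (d i)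

section fischer

variable {I M : Type*} [Fintype I] [AddCommGroup M] [Module ℝ M]
  {s : I → I → ℝ} {x d : I → Module.End ℝ M}

theorem fischerForm_succ (d : I → Module.End ℝ M) (k : ℕ) (u w : M) :
    fischerForm d (k + 1) u w = ∑ i, fischerForm d k (d i u) (d i w) := by
  simp [fischerForm, LinearMap.sum_apply]

theorem basis_toDual_self {ι M : Type*} [AddCommGroup M] [Module ℝ M] [DecidableEq ι]
    (b : Module.Basis ι ℝ M) (u : M) :
    b.toDual u u = ∑ i ∈ (b.repr u).support, (b.repr u i) ^ 2 := by
  conv_lhs => rw [← b.linearCombination_repr u]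
  simp [Finsupp.linearCombination_apply, Finsupp.sum, map_sum, LinearMap.sum_apply,
    Module.Basis.toDual_apply, pow_two]
  refine Finset.sum_congr rfl fun i _ => ?_
  split_ifs with h
  · simp [h]
  · rfl

theorem fischerForm_symm (d : I → Module.End ℝ M) (k : ℕ) (u w : M) :
    fischerForm d k u w = fischerForm d k w u := by
  induction k generalizing u w with
  | zero =>
    classical
    have h : (Module.Basis.ofVectorSpace ℝ M).toDual =
        (Module.Basis.ofVectorSpace ℝ M).toDual.flip := by
      refine (Module.Basis.ofVectorSpace ℝ M).ext fun i =>
        (Module.Basis.ofVectorSpace ℝ M).ext fun j => ?_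
      rw [LinearMap.flip_apply, Module.Basis.toDual_apply, Module.Basis.toDual_apply]
      simp only [eq_comm]
    exact congrArg (fun f => f u w) h
  | succ k ih => simp only [fischerForm_succ, ih (d _ u)]

theorem fischerForm_nonneg (d : I → Module.End ℝ M) (k : ℕ) (u : M) :
    0 ≤ fischerForm d k u u := by
  induction k generalizing u with
  | zero =>
    classical
    rw [fischerForm, basis_toDual_self]
    exact Finset.sum_nonneg fun i _ => sq_nonneg _
  | succ k ih =>
    rw [fischerForm_succ]
    exact Finset.sum_nonneg fun i _ => ih _

/-- The Fischer form is definite on a family of subspaces on which differentiation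
is jointly injective. -/
theorem fischerForm_definite {G : ℕ → Submodule ℝ M}
    (hG : ∀ k, ∀ u ∈ G (k + 1), ∀ i, d i u ∈ G k)
    (hG' : ∀ k, ∀ u ∈ G (k + 1), (∀ i, d i u = 0) → u = 0)
    (k : ℕ) (u : M) (hu : u ∈ G k) (h : fischerForm d k u u = 0) : u = 0 := by
  induction k generalizing u with
  | zero =>
    classical
    rw [fischerForm, basis_toDual_self,
      Finset.sum_eq_zero_iff_of_nonneg fun i _ => sq_nonneg _] at h
    apply (Module.Basis.ofVectorSpace ℝ M).repr.map_eq_zero_iff.1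
    ext i
    by_contra hi
    exact hi (by simpa using h i (Finsupp.mem_support_iff.2 hi))
  | succ k ih =>
    rw [fischerForm_succ,
      Finset.sum_eq_zero_iff_of_nonneg fun i _ => fischerForm_nonneg d k _] at h
    exact hG' k u hu fun i => ih _ (hG k u hu i) (h i (Finset.mem_univ i))

/-- The operators `x i ∘ d j` and `x j ∘ d i` are adjoint for the Fischer form. -/
theorem fischerForm_adjoint [DecidableEq I] (hs : IsSuperWeyl s x d) {G : ℕ → Submodule ℝ M}
    (hG0 : ∀ u ∈ G 0, ∀ i, d i u = 0)
    (hG : ∀ k, ∀ u ∈ G (k + 1), ∀ i, d i u ∈ G k)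
    (k : ℕ) (i j : I) (u w : M) (hu : u ∈ G k) (hw : w ∈ G k) :
    fischerForm d k (x i (d j u)) w = fischerForm d k u (x j (d i w)) := by
  induction k generalizing u w with
  | zero => simp [hG0 u hu, hG0 w hw]
  | succ k ih =>
    have hl : ∀ l, fischerForm d k (d l (x i (d j u))) (d l w) =
        (if l = i then fischerForm d k (d j u) (d i w) else 0) +
        (s l i * s l j) * fischerForm d k (d l u) (x j (d i (d l w))) := by
      intro l
      rw [hs.dx, hs.dd l j, ← ih _ _ (hG k u hu l) (hG k w hw l)]
      split_ifs with h
      · subst h; simp [mul_assoc]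
      · simp [mul_assoc]
    have hr : ∀ l, fischerForm d k (d l u) (d l (x j (d i w))) =
        (if l = j then fischerForm d k (d j u) (d i w) else 0) +
        (s l i * s l j) * fischerForm d k (d l u) (x j (d i (d l w))) := by
      intro l
      rw [hs.dx, hs.dd l i]
      split_ifs with h
      · subst h; simp; ring
      · simp; ring
    simp only [fischerForm_succ, hl, hr, Finset.sum_add_distrib, Finset.sum_ite_eq',
      Finset.mem_univ, if_true]

end fischer

/-- Canonical anticommutation relations. -/
structure IsCAR {I M : Type*} [DecidableEq I] [AddCommGroup M] [Module ℝ M]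
    (x d : I → Module.End ℝ M) : Prop where
  dx : ∀ i j u, d i (x j u) = (if i = j then u else 0) - x j (d i u)
  dd : ∀ i j u, d i (d j u) = - d j (d i u)
  xx : ∀ i j u, x i (x j u) = - x j (x i u)

/-- Stability under the operators spanning the symplectic Lie algebra. -/
structure SpStable {J M : Type*} [AddCommGroup M] [Module ℝ M]
    (x d : J ⊕ J → Module.End ℝ M) (U : Submodule ℝ M) : Prop where
  raise : ∀ j, ∀ u ∈ U, x (.inl j) (d (.inr j) u) ∈ U
  lower : ∀ j, ∀ u ∈ U, x (.inr j) (d (.inl j) u) ∈ U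
  raise₂ : ∀ i j, i ≠ j → ∀ u ∈ U, x (.inl j) (d (.inr i) u) + x (.inl i) (d (.inr j) u) ∈ U
  lower₂ : ∀ i j, i ≠ j → ∀ u ∈ U, x (.inr j) (d (.inl i) u) + x (.inr i) (d (.inl j) u) ∈ U
  mixed : ∀ i j, i ≠ j → ∀ u ∈ U, x (.inr i) (d (.inr j) u) - x (.inl j) (d (.inl i) u) ∈ U

namespace IsCAR

section basic

variable {I M : Type*} [DecidableEq I] [AddCommGroup M] [Module ℝ M]
  {x d : I → Module.End ℝ M}

theorem eq_zero_of_eq_neg {u : M} (h : u = -u) : u = 0 := by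
  have h2 : (2 : ℝ) • u = 0 := by rw [two_smul]; nth_rewrite 2 [h]; simp
  simpa using h2

theorem dd_self (h : IsCAR x d) (i : I) (u : M) : d i (d i u) = 0 :=
  eq_zero_of_eq_neg (h.dd i i u)

theorem xx_self (h : IsCAR x d) (i : I) (u : M) : x i (x i u) = 0 :=
  eq_zero_of_eq_neg (h.xx i i u)

theorem dx_self (h : IsCAR x d) (i : I) (u : M) : d i (x i u) = u - x i (d i u) := by
  simp [h.dx]

theorem dx_ne (h : IsCAR x d) {i j : I} (hij : i ≠ j) (u : M) : d i (x j u) = - x j (d i u) := by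
  simp [h.dx, hij]

theorem sum_d [Fintype I] (h : IsCAR x d) (i : I) (u : M) :
    ∑ c, x c (d c (d i u)) = d i (∑ c, x c (d c u)) - d i u := by
  simp only [map_sum, h.dx, Finset.sum_sub_distrib, Finset.sum_ite_eq, Finset.mem_univ, if_true]
  simp only [h.dd _ i, map_neg, Finset.sum_neg_distrib]
  abel

end basic

variable {J M : Type*} [DecidableEq J] [AddCommGroup M] [Module ℝ M]
  {x d : J ⊕ J → Module.End ℝ M}

theorem lower_raise_lower (h : IsCAR x d) (j : J) (u : M) :
    x (.inr j) (d (.inl j) (x (.inl j) (d (.inr j) (x (.inr j) (d (.inl j) u))))) =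
      x (.inr j) (d (.inl j) u) := by
  rw [h.dx_self (.inr j), h.dx_self (.inl j)]
  simp only [map_sub, h.dd_self, h.dx_ne (show Sum.inl j ≠ Sum.inr j by simp),
    h.dd (.inl j) (.inr j), h.xx_self, map_neg, map_zero]
  simp

/-- If the index `j` occurs in `u` only through pairs, and the mixed symplectic operators
preserve this property, then the derivative of `u` in another direction is determined by
the coefficient of the pair. -/
theorem d_eq_of_paired (h : IsCAR x d) {a b : J ⊕ J} (hab : a ≠ b) {p q : J ⊕ J}
    (hpa : p ≠ a) (hpb : p ≠ b) (hqa : q ≠ a) (hqb : q ≠ b) {u : M}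
    (hX : x a (d b u) = 0) (hZ : x b (d a u) = 0)
    (ε : ℝ) (hT : x b (d a (x a (d p u) + ε • x q (d b u))) = 0) :
    d p u = ε • x q (d a (d b u)) - x a (x b (d p (d a (d b u)))) := by
  have h2 : d a u = - x b (d a (d b u)) := by
    have := congrArg (d b) hZ
    rw [h.dx_self, map_zero, sub_eq_zero] at this
    rw [this, h.dd b a, map_neg]
  have e1 : d a (x a (d p u) + ε • x q (d b u)) =
      d p u - x a (d a (d p u)) - ε • x q (d a (d b u)) := by
    rw [map_add, h.dx_self, map_smul, h.dx_ne hqa.symm, smul_neg]; abel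
  have e2 : d a (d p u) = - x b (d p (d a (d b u))) := by
    rw [h.dd a p, h2, map_neg, h.dx_ne hpb]; abel
  have e0 : d b (d a (x a (d p u) + ε • x q (d b u))) = 0 := by
    have hg : d b (d a (d b u)) = 0 := by rw [h.dd b a, h.dd_self]; simp
    have hb : d b u = x a (d a (d b u)) := by
      have := congrArg (d a) hX
      rw [h.dx_self, map_zero, sub_eq_zero] at this
      exact this
    have hbp : d b (d p u) = x a (d p (d a (d b u))) := by
      rw [h.dd b p]
      nth_rewrite 1 [hb]
      rw [h.dx_ne hpa]; abel
    have hgp : d b (d p (d a (d b u))) = 0 := by rw [h.dd b p, hg]; simp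
    rw [e1, map_sub, map_sub, map_smul, h.dx_ne hab.symm, h.dx_ne hqb.symm, hg, hbp, e2, map_neg,
      h.dx_self, hgp]
    simp
  have e3 : d a (x a (d p u) + ε • x q (d b u)) = 0 := by
    have := congrArg (d b) hT
    rw [h.dx_self, e0] at this
    simpa using this
  rw [e1, e2] at e3
  rw [sub_sub, sub_eq_zero] at e3
  rw [e3, map_neg]; abel

/-- A nonzero symplectically stable space of harmonics of degree `q ≤ n` contains a nonzero
element divisible by the product of the `x (inl i)`, `i ∈ S`, and free of the `x (inr i)`,
whenever `|S| ≤ q`. -/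
theorem exists_saturated [Fintype J] (h : IsCAR x d) {U : Submodule ℝ M} (hU : SpStable x d U)
    {q : ℕ} (hq : q ≤ Fintype.card J)
    (hN : ∀ u ∈ U, ∑ c, x c (d c u) = (q : ℝ) • u)
    (hF : ∀ u ∈ U, ∑ j, d (.inl j) (d (.inr j) u) = 0) (hne : U ≠ ⊥)
    (S : Finset J) (hS : S.card ≤ q) :
    ∃ u ∈ U, u ≠ 0 ∧ ∀ i ∈ S, x (.inl i) u = 0 ∧ d (.inr i) u = 0 := by
  induction S using Finset.induction_on with
  | empty =>
    obtain ⟨u, hu, hu0⟩ := U.ne_bot_iff.1 hne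
    exact ⟨u, hu, hu0, by simp⟩
  | insert j S hjS ih =>
    rw [Finset.card_insert_of_notMem hjS] at hS
    obtain ⟨u, hu, hu0, huS⟩ := ih (by omega)
    by_contra hcon
    push Not at hcon
    have hpres : ∀ (y p r : Module.End ℝ M), (∀ v, y (p v) = - p (y v)) →
        (∀ v, y (r v) = - r (y v)) → ∀ v, y v = 0 → y (p (r v)) = 0 := by
      intro y p r hp hr v hv
      rw [hp, hr, hv]; simp
    have hX : ∀ v ∈ U, (∀ i ∈ S, x (.inl i) v = 0 ∧ d (.inr i) v = 0) →
        x (.inl j) (d (.inr j) v) = 0 := by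
      intro v hv hvS
      by_contra h0
      obtain ⟨i, hi, hi'⟩ := hcon _ (hU.raise j v hv) h0
      rcases Finset.mem_insert.1 hi with rfl | hi
      · exact hi' (h.xx_self _ _) (by
          rw [h.dx_ne (by simp), h.dd_self]; simp)
      · have hij : i ≠ j := fun e => hjS (e ▸ hi)
        refine hi' (hpres _ _ _ (h.xx _ _) (fun w => ?_) v (hvS i hi).1)
          (hpres _ _ _ (fun w => h.dx_ne (by simp) _) (h.dd _ _) v (hvS i hi).2)
        rw [h.dx_ne (by simp)]; simp
    have hZ : ∀ v ∈ U, (∀ i ∈ S, x (.inl i) v = 0 ∧ d (.inr i) v = 0) →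
        x (.inr j) (d (.inl j) v) = 0 := by
      intro v hv hvS
      have := hX _ (hU.lower j v hv) fun i hi => by
        have hij : i ≠ j := fun e => hjS (e ▸ hi)
        refine ⟨hpres _ _ _ (h.xx _ _) (fun w => ?_) v (hvS i hi).1,
          hpres _ _ _ (fun w => h.dx_ne (by simp [hij]) _) (h.dd _ _) v (hvS i hi).2⟩
        rw [h.dx_ne (by simpa using hij.symm)]; simp
      rw [← h.lower_raise_lower, this]; simp
    set g := d (.inl j) (d (.inr j) u) with hg
    have hr : ∀ i, i ∉ S → i ≠ j → d (.inr i) u =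
        x (.inl i) g - x (.inl j) (x (.inr j) (d (.inr i) g)) := by
      intro i hi hij
      have key := hZ _ (hU.raise₂ i j hij u hu) fun l hl => by
        have hlj : l ≠ j := fun e => hjS (e ▸ hl)
        have hli : l ≠ i := fun e => hi (e ▸ hl)
        rw [map_add, map_add,
          hpres _ _ _ (h.xx _ _) (fun w => ?_) u (huS l hl).1,
          hpres _ _ _ (h.xx _ _) (fun w => ?_) u (huS l hl).1,
          hpres _ _ _ (fun w => h.dx_ne (by simp) _) (h.dd _ _) u (huS l hl).2,
          hpres _ _ _ (fun w => h.dx_ne (by simp) _) (h.dd _ _) u (huS l hl).2]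
        · simp
        · rw [h.dx_ne (by simp)]; simp
        · rw [h.dx_ne (by simp)]; simp
      have := h.d_eq_of_paired (a := .inl j) (b := .inr j) (p := .inr i) (q := .inl i)
        (by simp) (by simp) (by simpa using hij) (by simpa using hij)
        (by simp) (hX u hu huS) (hZ u hu huS) 1 (by rw [one_smul]; exact key)
      rwa [one_smul] at this
    have hl : ∀ i, i ∉ S → i ≠ j → d (.inl i) u =
        - x (.inr i) g - x (.inl j) (x (.inr j) (d (.inl i) g)) := by
      intro i hi hij
      have key := hZ _ (hU.mixed i j hij u hu) fun l hl => by
        have hlj : l ≠ j := fun e => hjS (e ▸ hl)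
        have hli : l ≠ i := fun e => hi (e ▸ hl)
        rw [map_sub, map_sub,
          hpres _ _ _ (h.xx _ _) (fun w => ?_) u (huS l hl).1,
          hpres _ _ _ (h.xx _ _) (fun w => ?_) u (huS l hl).1,
          hpres _ _ _ (fun w => h.dx_ne (by simpa using hli) _) (h.dd _ _) u (huS l hl).2,
          hpres _ _ _ (fun w => h.dx_ne (by simp) _) (h.dd _ _) u (huS l hl).2]
        · simp
        · rw [h.dx_ne (by simpa using hli.symm)]; simp
        · rw [h.dx_ne (by simp)]; simp
      have := h.d_eq_of_paired (a := .inl j) (b := .inr j) (p := .inl i) (q := .inr i)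
        (by simp) (by simpa using hij) (by simp) (by simp)
        (by simpa using hij) (hX u hu huS) (hZ u hu huS) (-1) (by
          rw [← neg_eq_zero, ← map_neg, ← map_neg, neg_one_smul, ← sub_eq_add_neg, neg_sub]
          exact key)
      rwa [neg_one_smul] at this
    have hsplit : ∀ f : J → M, ∑ i, f i = f j + ∑ i ∈ S, f i + ∑ i ∈ (insert j S)ᶜ, f i := by
      intro f
      rw [← Finset.sum_insert hjS, Finset.sum_add_sum_compl]
    have hout : ∀ i ∈ (insert j S)ᶜ, i ∉ S ∧ i ≠ j := by
      intro i hi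
      simp only [Finset.mem_compl, Finset.mem_insert, not_or] at hi
      exact ⟨hi.2, hi.1⟩
    have hSg : ∀ i ∈ S, x (.inl i) g = 0 ∧ d (.inr i) g = 0 := by
      intro i hi
      have hij : i ≠ j := fun e => hjS (e ▸ hi)
      refine ⟨hpres _ _ _ (fun w => ?_) (fun w => ?_) u (huS i hi).1,
        hpres _ _ _ (h.dd _ _) (h.dd _ _) u (huS i hi).2⟩
      · rw [h.dx_ne (by simpa using hij.symm)]; simp
      · rw [h.dx_ne (by simp)]; simp
    have hαg : d (.inl j) g = 0 := h.dd_self _ _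
    have hβg : d (.inr j) g = 0 := by rw [hg, h.dd (.inr j), h.dd_self]; simp
    have hFg : ∑ i ∈ (insert j S)ᶜ, d (.inl i) (d (.inr i) g) = 0 := by
      have h1 : ∑ i, d (.inl i) (d (.inr i) g) = 0 := by
        have h2 : ∀ i, d (.inl i) (d (.inr i) g) =
            d (.inl j) (d (.inr j) (d (.inl i) (d (.inr i) u))) := by
          intro i
          simp only [hg]
          rw [h.dd (.inr i) (.inl j), h.dd (.inr i) (.inr j), map_neg,
            h.dd (.inl i) (.inl j), map_neg, map_neg, h.dd (.inl i) (.inr j)]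
          simp only [map_neg, neg_neg]
        simp only [h2]
        rw [← map_sum, ← map_sum, hF u hu]; simp
      rw [hsplit, hβg, Finset.sum_eq_zero fun i hi => by rw [(hSg i hi).2, map_zero]] at h1
      simpa using h1
    have hFu : ∑ i ∈ (insert j S)ᶜ, d (.inl i) (d (.inr i) u) = - g := by
      have h1 := hF u hu
      rw [hsplit, ← hg, Finset.sum_eq_zero fun i hi => by rw [(huS i hi).2, map_zero],
        add_zero] at h1
      exact (neg_eq_of_add_eq_zero_right h1).symm
    have hab : ∀ (c : J ⊕ J) (v : M), c ≠ .inl j → c ≠ .inr j →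
        d c (x (.inl j) (x (.inr j) v)) = x (.inl j) (x (.inr j) (d c v)) := by
      intro c v h1 h2
      rw [h.dx_ne h1, h.dx_ne h2]; simp
    have e1 : ∀ i ∈ (insert j S)ᶜ, d (.inl i) (d (.inr i) u) = g - x (.inl i) (d (.inl i) g) -
        x (.inl j) (x (.inr j) (d (.inl i) (d (.inr i) g))) := by
      intro i hi
      rw [hr i (hout i hi).1 (hout i hi).2, map_sub, h.dx_self,
        hab _ _ (by simpa using (hout i hi).2) (by simp)]
    have e2 : ∀ i ∈ (insert j S)ᶜ, d (.inl i) (d (.inr i) u) = g - x (.inr i) (d (.inr i) g) -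
        x (.inl j) (x (.inr j) (d (.inl i) (d (.inr i) g))) := by
      intro i hi
      rw [h.dd (.inl i), hl i (hout i hi).1 (hout i hi).2, map_sub, map_neg, h.dx_self,
        hab _ _ (by simp) (by simpa using (hout i hi).2), h.dd (.inr i) (.inl i)]
      simp only [map_neg]; abel
    have hABsum : ∑ i ∈ (insert j S)ᶜ,
        x (.inl j) (x (.inr j) (d (.inl i) (d (.inr i) g))) = 0 := by
      rw [← map_sum, ← map_sum, hFg]; simp
    have f1 := hFu
    have f2 := hFu
    rw [Finset.sum_congr rfl e1, Finset.sum_sub_distrib, Finset.sum_sub_distrib, hABsum,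
      sub_zero, Finset.sum_const, ← Nat.cast_smul_eq_nsmul ℝ,
      Finset.card_compl, Finset.card_insert_of_notMem hjS, Nat.cast_sub (by omega)] at f1
    rw [Finset.sum_congr rfl e2, Finset.sum_sub_distrib, Finset.sum_sub_distrib, hABsum,
      sub_zero, Finset.sum_const, ← Nat.cast_smul_eq_nsmul ℝ,
      Finset.card_compl, Finset.card_insert_of_notMem hjS, Nat.cast_sub (by omega)] at f2
    have hNg : ∑ c, x c (d c g) = (q - 2 : ℝ) • g := by
      rw [hg, h.sum_d, h.sum_d, hN u hu, map_sub, map_smul, map_smul]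
      module
    have hNS : ∀ i ∈ S, x (.inl i) (d (.inl i) g) = g := by
      intro i hi
      have := h.dx_self (.inl i) g
      rw [(hSg i hi).1, map_zero] at this
      exact (sub_eq_zero.1 this.symm).symm
    rw [Fintype.sum_sum_type, hsplit, hsplit, Finset.sum_congr rfl hNS, hαg, hβg,
      Finset.sum_eq_zero (s := S) (f := fun i => x (.inr i) (d (.inr i) g))
        (fun i hi => by rw [(hSg i hi).2, map_zero]), Finset.sum_const,
      ← Nat.cast_smul_eq_nsmul ℝ, map_zero, map_zero] at hNg
    have hg0 : (2 * (Fintype.card J : ℝ) - S.card - q + 2) • g = 0 := by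
      rw [sub_eq_iff_eq_add', ← sub_eq_iff_eq_add, eq_comm] at f1 f2
      rw [f1, f2] at hNg
      rw [← sub_eq_zero] at hNg
      rw [← hNg]
      push_cast
      module
    have hcoef : (2 * (Fintype.card J : ℝ) - S.card - q + 2) ≠ 0 := by
      have h1 : (q : ℝ) ≤ Fintype.card J := by exact_mod_cast hq
      have h2 : (S.card : ℝ) + 1 ≤ q := by exact_mod_cast hS
      nlinarith
    have hg1 : g = 0 := (smul_eq_zero.1 hg0).resolve_left hcoef
    have hβj : d (.inr j) u = 0 := by
      have := congrArg (d (.inl j)) (hX u hu huS)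
      rw [h.dx_self, ← hg, hg1, map_zero, map_zero, sub_zero] at this
      exact this
    have hαj : d (.inl j) u = 0 := by
      have := congrArg (d (.inr j)) (hZ u hu huS)
      rw [h.dx_self, h.dd (.inr j), ← hg, hg1, neg_zero, map_zero, map_zero, sub_zero] at this
      exact this
    have hNu := hN u hu
    have hNS' : ∀ i ∈ S, x (.inl i) (d (.inl i) u) = u := by
      intro i hi
      have := h.dx_self (.inl i) u
      rw [(huS i hi).1, map_zero] at this
      exact (sub_eq_zero.1 this.symm).symm
    rw [Fintype.sum_sum_type, hsplit, hsplit, Finset.sum_congr rfl hNS', hαj, hβj,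
      Finset.sum_eq_zero (s := S) (f := fun i => x (.inr i) (d (.inr i) u))
        (fun i hi => by rw [(huS i hi).2, map_zero]), Finset.sum_const,
      ← Nat.cast_smul_eq_nsmul ℝ, map_zero, map_zero,
      Finset.sum_eq_zero (s := (insert j S)ᶜ) (f := fun i => x (.inl i) (d (.inl i) u))
        (fun i hi => by rw [hl i (hout i hi).1 (hout i hi).2, hg1]; simp),
      Finset.sum_eq_zero (s := (insert j S)ᶜ) (f := fun i => x (.inr i) (d (.inr i) u))
        (fun i hi => by rw [hr i (hout i hi).1 (hout i hi).2, hg1]; simp)] at hNu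
    simp only [zero_add, add_zero] at hNu
    rw [← sub_eq_zero, ← sub_smul, smul_eq_zero, sub_eq_zero] at hNu
    rcases hNu with h1 | h1
    · have : S.card = q := by exact_mod_cast h1
      omega
    · exact hu0 h1

end IsCAR

/-- Raising and lowering operators on a graded family of subspaces, of degrees `2` and `-2`,
whose commutator acts on degree `d` as the scalar `c d`. -/
structure IsLadder {M : Type*} [AddCommGroup M] [Module ℝ M] (E F : Module.End ℝ M)
    (G : ℕ → Submodule ℝ M) (c : ℕ → ℝ) : Prop where
  comm : ∀ d, ∀ u ∈ G d, F (E u) = E (F u) + c d • u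
  up : ∀ d, ∀ u ∈ G d, E u ∈ G (d + 2)
  down : ∀ d, ∀ u ∈ G (d + 2), F u ∈ G d
  down_lt : ∀ d < 2, ∀ u ∈ G d, F u = 0

namespace IsLadder

variable {M : Type*} [AddCommGroup M] [Module ℝ M] {E F : Module.End ℝ M}
    {G : ℕ → Submodule ℝ M} {c : ℕ → ℝ}

theorem eq_zero_of_lower_raise (h : IsLadder E F G c) (d : ℕ) (hc : ∀ j ≤ d, c j < 0) (p : M)
    (hp : p ∈ G d) (r : ℝ) (hr : 0 ≤ r) (hE : F (E p) = r • p) : p = 0 := by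
  induction d using Nat.strong_induction_on generalizing p r with
  | _ d ih =>
    have hcd := hc d le_rfl
    have h1 : E (F p) = (r - c d) • p := by
      rw [sub_smul, ← hE, h.comm d p hp]; abel
    have hpos : r - c d ≠ 0 := by linarith
    have hFp : F p = 0 := by
      rcases lt_or_ge d 2 with hd | hd
      · exact h.down_lt d hd p hp
      · obtain ⟨e, rfl⟩ := Nat.exists_eq_add_of_le' hd
        refine ih e (by omega) (fun j hj => hc j (by omega)) _ (h.down e p hp) (r - c (e + 2))
          (by linarith) ?_
        rw [h1, map_smul]
    rw [hFp, map_zero] at h1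
    exact (smul_eq_zero.1 h1.symm).resolve_left hpos

theorem eq_zero_of_raise_lower (h : IsLadder E F G c) (K : ℕ) (hK : ∀ j, K < j → G j = ⊥)
    (d : ℕ) (hc : ∀ j, d ≤ j → 0 < c j) (p : M)
    (hp : p ∈ G d) (r : ℝ) (hr : 0 ≤ r) (hE : E (F p) = r • p) : p = 0 := by
  induction hk : K + 2 - d using Nat.strong_induction_on generalizing d p r with
  | _ k ih =>
    rcases lt_or_ge K d with hd | hd
    · rw [hK d hd] at hp
      exact (Submodule.mem_bot ℝ).1 hp
    have hcd := hc d le_rfl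
    have h1 : F (E p) = (r + c d) • p := by rw [h.comm d p hp, hE, add_smul]
    have h2 : E p = 0 := by
      refine ih (K + 2 - (d + 2)) (by omega) (d + 2) (fun j hj => hc j (by omega)) _ (h.up d p hp)
        (r + c d) (by linarith) ?_ rfl
      rw [h1, map_smul]
    rw [h2, map_zero] at h1
    exact (smul_eq_zero.1 h1.symm).resolve_left (by linarith)

theorem pow_mem (h : IsLadder E F G c) (q a : ℕ) (u : M) (hu : u ∈ G q) :
    (E ^ a) u ∈ G (q + 2 * a) := by
  induction a with
  | zero => simpa using hu
  | succ a ih =>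
    rw [pow_succ', Module.End.mul_apply]
    exact h.up _ _ ih

theorem lower_pow (h : IsLadder E F G c) (q : ℕ) (u : M) (hu : u ∈ G q) (hF : F u = 0)
    (s : ℕ → ℝ) (hs0 : s 0 = 0) (hs : ∀ a, s (a + 1) = s a + c (q + 2 * a)) (a : ℕ) :
    F ((E ^ (a + 1)) u) = s (a + 1) • (E ^ a) u := by
  induction a with
  | zero => simp [h.comm q u hu, hF, hs, hs0]
  | succ a ih =>
    rw [pow_succ' E (a + 1), Module.End.mul_apply, h.comm _ _ (h.pow_mem q (a + 1) u hu), ih,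
      map_smul, ← Module.End.mul_apply, ← pow_succ', ← add_smul, ← hs]

theorem exists_lower_raise (h : IsLadder E F G c) (d : ℕ) [FiniteDimensional ℝ (G d)]
    (hc : ∀ j ≤ d, c j < 0) (p : M) (hp : p ∈ G d) : ∃ p' ∈ G d, F (E p') = p := by
  let T : G d →ₗ[ℝ] G d := (F ∘ₗ E).restrict fun u hu => h.down d _ (h.up d u hu)
  have hT : Function.Injective T := by
    rw [← LinearMap.ker_eq_bot, LinearMap.ker_eq_bot']
    intro u hu
    have h1 : F (E u) = 0 := congrArg Subtype.val hu
    exact Subtype.ext (h.eq_zero_of_lower_raise d hc u u.2 0 le_rfl (by rw [h1, zero_smul]))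
  obtain ⟨p', hp'⟩ := (LinearMap.injective_iff_surjective.1 hT) ⟨p, hp⟩
  exact ⟨p', p'.2, congrArg Subtype.val hp'⟩

theorem exists_harmonic_add (h : IsLadder E F G c) (d : ℕ) [FiniteDimensional ℝ (G d)]
    (hc : ∀ j ≤ d, c j < 0) (p : M) (hp : p ∈ G (d + 2)) :
    ∃ u ∈ G (d + 2), F u = 0 ∧ ∃ p' ∈ G d, p = u + E p' := by
  obtain ⟨p', hp', h1⟩ := h.exists_lower_raise d hc (F p) (h.down d p hp)
  exact ⟨p - E p', sub_mem hp (h.up d p' hp'), by rw [map_sub, h1, sub_self], p', hp', by abel⟩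

theorem exists_raise (h : IsLadder E F G c) (K : ℕ) (hK : ∀ j, K < j → G j = ⊥)
    (d : ℕ) [FiniteDimensional ℝ (G (d + 2))] (hc : ∀ j, d + 2 ≤ j → 0 < c j) (p : M)
    (hp : p ∈ G (d + 2)) : ∃ p' ∈ G d, p = E p' := by
  let T : G (d + 2) →ₗ[ℝ] G (d + 2) :=
    (E ∘ₗ F).restrict fun u hu => h.up d _ (h.down d u hu)
  have hT : Function.Injective T := by
    rw [← LinearMap.ker_eq_bot, LinearMap.ker_eq_bot']
    intro u hu
    have h1 : E (F u) = 0 := congrArg Subtype.val hu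
    exact Subtype.ext
      (h.eq_zero_of_raise_lower K hK (d + 2) hc u u.2 0 le_rfl (by rw [h1, zero_smul]))
  obtain ⟨p', hp'⟩ := (LinearMap.injective_iff_surjective.1 hT) ⟨p, hp⟩
  exact ⟨F p', h.down d _ p'.2, (congrArg Subtype.val hp').symm⟩

end IsLadder

/-- The operator `E` of an anticommuting system. -/
def carE {J M : Type*} [Fintype J] [AddCommGroup M] [Module ℝ M] (x : J ⊕ J → Module.End ℝ M) :
    Module.End ℝ M := ∑ j, x (.inl j) * x (.inr j)

theorem carE_apply {J M : Type*} [Fintype J] [AddCommGroup M] [Module ℝ M]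
    (x : J ⊕ J → Module.End ℝ M) (u : M) : carE x u = ∑ j, x (.inl j) (x (.inr j) u) := by
  simp [carE, LinearMap.sum_apply]

/-- The commutator of the two quadratic elements of an anticommuting system. -/
theorem carE_comm {J M : Type*} [Fintype J] [DecidableEq J] [AddCommGroup M] [Module ℝ M]
    {x d : J ⊕ J → Module.End ℝ M}
    (h : ∀ i j u, d i (x j u) = (if i = j then u else 0) - x j (d i u))
    (u : M) :
    carE d (carE x u) = carE x (carE d u) + ∑ c, x c (d c u) - (Fintype.card J : ℝ) • u := by
  have h1 : ∀ j, d (.inl j) (d (.inr j) (carE x u)) = carE x (d (.inl j) (d (.inr j) u)) +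
      (x (.inl j) (d (.inl j) u) + x (.inr j) (d (.inr j) u)) - u := by
    intro j
    have e1 : ∀ v, d (.inr j) (carE x v) = carE x (d (.inr j) v) - x (.inl j) v := by
      intro v
      have : ∀ i, d (.inr j) (x (.inl i) (x (.inr i) v)) =
          x (.inl i) (x (.inr i) (d (.inr j) v)) - if j = i then x (.inl j) v else 0 := by
        intro i
        rw [h, h]
        by_cases hij : j = i
        · subst hij; simp
        · simp [hij]
      rw [carE_apply, map_sum, Finset.sum_congr rfl fun i _ => this i, Finset.sum_sub_distrib,
        ← carE_apply]
      simp
    have e2 : ∀ v, d (.inl j) (carE x v) = carE x (d (.inl j) v) + x (.inr j) v := by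
      intro v
      have : ∀ i, d (.inl j) (x (.inl i) (x (.inr i) v)) =
          x (.inl i) (x (.inr i) (d (.inl j) v)) + if j = i then x (.inr j) v else 0 := by
        intro i
        rw [h, h]
        by_cases hij : j = i
        · subst hij; simp; abel
        · simp [hij]
      rw [carE_apply, map_sum, Finset.sum_congr rfl fun i _ => this i, Finset.sum_add_distrib,
        ← carE_apply]
      simp
    rw [e1, map_sub, e2, h]
    simp
    abel
  rw [carE_apply d, Finset.sum_congr rfl fun j _ => h1 j, Finset.sum_sub_distrib,
    Finset.sum_add_distrib, ← map_sum, ← carE_apply, Finset.sum_add_distrib, Fintype.sum_sum_type]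
  simp [Nat.cast_smul_eq_nsmul]

/-- The indices of the fermionic variables, split into the two members of each pair. -/
def fidx (n : ℕ) : Fin n ⊕ Fin n → Fin (2 * n)
  | .inl j => ⟨2 * j.1, by omega⟩
  | .inr j => ⟨2 * j.1 + 1, by omega⟩

theorem fidx_injective (n : ℕ) : Function.Injective (fidx n) := by
  rintro (i | i) (j | j) h <;> simp only [fidx, Fin.mk.injEq] at h
  · exact congrArg Sum.inl (Fin.ext (by omega))
  · omega
  · omega
  · exact congrArg Sum.inr (Fin.ext (by omega))

theorem fidx_bijective (n : ℕ) : Function.Bijective (fidx n) := by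
  refine ⟨fidx_injective n, fun i => ?_⟩
  rcases Nat.even_or_odd' i.1 with ⟨k, hk | hk⟩
  · exact ⟨.inl ⟨k, by omega⟩, Fin.ext hk.symm⟩
  · exact ⟨.inr ⟨k, by omega⟩, Fin.ext hk.symm⟩

theorem sum_fidx {M : Type*} [AddCommMonoid M] (f : Fin (2 * n) → M) :
    ∑ c, f (fidx n c) = ∑ i, f i :=
  (fidx_bijective n).sum_comp f

/-- Multiplication by the fermionic generators. -/
def fx (c : Fin n ⊕ Fin n) : Module.End ℝ (Grass n) := LinearMap.mulLeft ℝ (fgen n (fidx n c))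

/-- The fermionic derivatives. -/
def fd (c : Fin n ⊕ Fin n) : Module.End ℝ (Grass n) := fpderiv n (fidx n c)

theorem fpderiv_ι_mul (i : Fin (2 * n)) (v : Fin (2 * n) → ℝ) (u : Grass n) :
    fpderiv n i (ExteriorAlgebra.ι ℝ v * u) = v i • u - ExteriorAlgebra.ι ℝ v * fpderiv n i u :=
  CliffordAlgebra.contractLeft_ι_mul _ _ _

theorem fpderiv_one (i : Fin (2 * n)) : fpderiv n i 1 = 0 :=
  CliffordAlgebra.contractLeft_one _ _

theorem ι_mul_swap (v w : Fin (2 * n) → ℝ) : ExteriorAlgebra.ι ℝ v * ExteriorAlgebra.ι ℝ w =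
    - (ExteriorAlgebra.ι ℝ w * ExteriorAlgebra.ι ℝ v) :=
  eq_neg_of_add_eq_zero_left (ExteriorAlgebra.ι_add_mul_swap v w)

theorem isCAR_fermion : IsCAR (fx (n := n)) fd where
  dx i j u := by
    simp only [fx, fd, LinearMap.mulLeft_apply, fgen, fpderiv_ι_mul]
    by_cases h : i = j
    · subst h; simp
    · rw [Pi.single_eq_of_ne (fun e => h (fidx_injective n e))]; simp [h]
  dd i j u := CliffordAlgebra.contractLeft_comm _ _ _
  xx i j u := by
    simp only [fx, LinearMap.mulLeft_apply, fgen, ← mul_assoc]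
    rw [ι_mul_swap, neg_mul]

theorem lapF_eq : lapF n = (4 : ℝ) • carE fd := rfl

theorem mulLeft_rf2 : LinearMap.mulLeft ℝ (rf2 n) = carE fx := by
  ext u
  simp [carE_apply, rf2, fx, Finset.sum_mul, mul_assoc, fidx]

theorem sum_smul_fgen (v : Fin (2 * n) → ℝ) : ∑ i, v i • fgen n i = ExteriorAlgebra.ι ℝ v := by
  simp only [fgen, ← map_smul, ← map_sum]
  congr 1
  ext i
  simp [Finset.sum_apply, Pi.single_apply]

theorem fgrade_induction {q : ℕ} {p : ℕ → Grass n → Prop} 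
    (zero : ∀ r : ℝ, p 0 (algebraMap ℝ _ r))
    (add : ∀ q u w, p q u → p q w → p q (u + w))
    (mul : ∀ q v u, u ∈ fgrade n q → p q u → p (q + 1) (ExteriorAlgebra.ι ℝ v * u)) {u : Grass n}
    (hu : u ∈ fgrade n q) : p q u := by
  refine Submodule.pow_induction_on_left' _ (C := fun q u _ => p q u) zero
    (fun u w i _ _ => add i u w) ?_ hu
  rintro _ ⟨v, rfl⟩ i u hu h
  exact mul i v u hu h

theorem number_fermion (q : ℕ) (u : Grass n) (hu : u ∈ fgrade n q) :
    ∑ c, fx c (fd c u) = (q : ℝ) • u := by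
  have : ∀ u : Grass n, ∑ c, fx c (fd c u) = ∑ i, fgen n i * fpderiv n i u := fun u =>
    sum_fidx (fun i => fgen n i * fpderiv n i u)
  rw [this]
  refine fgrade_induction (p := fun q u => ∑ i, fgen n i * fpderiv n i u = (q : ℝ) • u)
    ?_ ?_ ?_ hu
  · intro r
    simp [Algebra.algebraMap_eq_smul_one, fpderiv_one]
  · intro q u w h1 h2
    simp only [map_add, mul_add, Finset.sum_add_distrib, smul_add]
    rw [h1, h2]
  · intro q v u _ h
    have h1 : ∀ i, fgen n i * fpderiv n i (ExteriorAlgebra.ι ℝ v * u) =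
        (v i • fgen n i) * u + ExteriorAlgebra.ι ℝ v * (fgen n i * fpderiv n i u) := by
      intro i
      have h2 : fgen n i * ExteriorAlgebra.ι ℝ v = - (ExteriorAlgebra.ι ℝ v * fgen n i) :=
        ι_mul_swap _ _
      rw [fpderiv_ι_mul, mul_sub, ← mul_assoc, h2]
      simp [mul_assoc]
    simp only [h1, Finset.sum_add_distrib, ← Finset.mul_sum, ← Finset.sum_mul, h, sum_smul_fgen]
    rw [mul_smul_comm, Nat.cast_succ, add_smul, one_smul, add_comm]

theorem ι_mul_mem_fgrade {q : ℕ} (v : Fin (2 * n) → ℝ) {u : Grass n} (hu : u ∈ fgrade n q) :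
    ExteriorAlgebra.ι ℝ v * u ∈ fgrade n (q + 1) := by
  rw [fgrade, pow_succ']
  exact Submodule.mul_mem_mul ⟨v, rfl⟩ hu

theorem fx_mem {q : ℕ} (c : Fin n ⊕ Fin n) {u : Grass n} (hu : u ∈ fgrade n q) :
    fx c u ∈ fgrade n (q + 1) := ι_mul_mem_fgrade _ hu

theorem fpderiv_fgrade_zero (i : Fin (2 * n)) {u : Grass n} (hu : u ∈ fgrade n 0) :
    fpderiv n i u = 0 := by
  rw [fgrade, pow_zero, Submodule.mem_one] at hu
  obtain ⟨r, rfl⟩ := hu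
  rw [Algebra.algebraMap_eq_smul_one, map_smul, fpderiv_one, smul_zero]

theorem fpderiv_mem {q : ℕ} (i : Fin (2 * n)) {u : Grass n} (hu : u ∈ fgrade n (q + 1)) :
    fpderiv n i u ∈ fgrade n q := by
  have h := fgrade_induction (p := fun q u => fpderiv n i u ∈ fgrade n (q - 1))
    (fun r => by
      rw [Algebra.algebraMap_eq_smul_one, map_smul, fpderiv_one, smul_zero]; exact zero_mem _)
    (fun q u w h1 h2 => by rw [map_add]; exact add_mem h1 h2)
    (fun q v u hu h => by
      rw [fpderiv_ι_mul]
      refine sub_mem (Submodule.smul_mem _ _ hu) ?_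
      rcases q with _ | q
      · rw [fpderiv_fgrade_zero i hu, mul_zero]; exact zero_mem _
      · exact ι_mul_mem_fgrade v h) hu
  exact h

theorem carE_fx_mem {q : ℕ} {u : Grass n} (hu : u ∈ fgrade n q) :
    carE fx u ∈ fgrade n (q + 2) := by
  rw [carE_apply]
  exact sum_mem fun j _ => fx_mem _ (fx_mem _ hu)

theorem fd_mem {q : ℕ} (c : Fin n ⊕ Fin n) {u : Grass n} (hu : u ∈ fgrade n (q + 1)) :
    fd c u ∈ fgrade n q := fpderiv_mem _ hu

theorem isLadder_fermion : IsLadder (carE fx) (lapF n) (fgrade n) fun d => 4 * ((d : ℝ) - n) where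
  comm d u hu := by
    simp only [lapF_eq, LinearMap.smul_apply, map_smul]
    rw [carE_comm isCAR_fermion.dx, number_fermion d u hu, Fintype.card_fin]
    module
  up d u hu := carE_fx_mem hu
  down d u hu := by
    rw [lapF_eq, LinearMap.smul_apply, carE_apply]
    exact Submodule.smul_mem _ _ (sum_mem fun j _ => fd_mem _ (fd_mem _ hu))
  down_lt d hd u hu := by
    rw [lapF_eq, LinearMap.smul_apply, carE_apply]
    refine smul_eq_zero_of_right _ (Finset.sum_eq_zero fun j _ => ?_)
    interval_cases d
    · rw [show fd (.inr j) u = 0 from fpderiv_fgrade_zero _ hu, map_zero]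
    · exact fpderiv_fgrade_zero _ (fd_mem _ hu)

theorem fgrade_eq_bot (q : ℕ) (hq : 2 * n < q) : fgrade n q = ⊥ := by
  have h : Module.finrank ℝ (fgrade n q) = 0 := by
    have := exteriorPower.finrank_eq (R := ℝ) (M := Fin (2 * n) → ℝ) q
    rw [Module.finrank_fin_fun, Nat.choose_eq_zero_of_lt hq] at this
    exact this
  have : Module.Finite ℝ (fgrade n q) :=
    inferInstanceAs (Module.Finite ℝ (⋀[ℝ]^q (Fin (2 * n) → ℝ)))
  exact Submodule.finrank_eq_zero.1 h

instance fgrade_finite (q : ℕ) : FiniteDimensional ℝ (fgrade n q) :=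
  inferInstanceAs (Module.Finite ℝ (⋀[ℝ]^q (Fin (2 * n) → ℝ)))

theorem Hf_eq_zero {q : ℕ} (hq : n < q) {u : Grass n} (hu : u ∈ Hf n q) : u = 0 := by
  refine isLadder_fermion.eq_zero_of_raise_lower (2 * n) (fun j => fgrade_eq_bot j) q
    (fun j hj => ?_) u hu.1 0 le_rfl ?_
  · have : (n : ℝ) < j := by exact_mod_cast lt_of_lt_of_le hq hj
    linarith
  · rw [show lapF n u = 0 from hu.2]; simp

theorem lapF_pow {q : ℕ} {u : Grass n} (hu : u ∈ Hf n q) (a : ℕ) :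
    lapF n ((carE fx ^ (a + 1)) u) =
      (4 * ((a : ℝ) + 1) * (q + a - n)) • (carE fx ^ a) u := by
  rw [isLadder_fermion.lower_pow q u hu.1 hu.2 (fun a => 4 * (a : ℝ) * (q + a - 1 - n))]
  · congr 1; push_cast; ring
  · simp
  · intro a; push_cast; ring

theorem pow_Hf_eq_zero {q b : ℕ} (hq : q ≤ n) (hb : n - q < b) {u : Grass n} (hu : u ∈ Hf n q) :
    (carE fx ^ b) u = 0 := by
  have h : (carE fx ^ (n - q + 1)) u = 0 := by
    have h1 := isLadder_fermion.pow_mem q (n - q + 1) u hu.1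
    refine Hf_eq_zero (q := q + 2 * (n - q + 1)) (by omega) ⟨h1, ?_⟩
    show lapF n _ = 0
    rw [lapF_pow hu]
    rw [Nat.cast_sub hq]; simp
  obtain ⟨e, rfl⟩ := Nat.exists_eq_add_of_le' (show n - q + 1 ≤ b from hb)
  rw [pow_add, Module.End.mul_apply, h, map_zero]

/-- The powers of `rf2` applied to symplectic harmonics span the Grassmann algebra. -/
theorem fgrade_le_of_pow_mem (hn : 1 ≤ n) (i : ℕ) (W : Submodule ℝ (Grass n))
    (hW : ∀ q b, q + 2 * b = i → q + b ≤ n → ∀ h ∈ Hf n q, (carE fx ^ b) h ∈ W) :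
    fgrade n i ≤ W := by
  induction i using Nat.strong_induction_on generalizing W with
  | _ i ih =>
    intro u hu
    rcases lt_or_ge i 2 with hi | hi
    · exact hW i 0 (by omega) (by omega) u ⟨hu, isLadder_fermion.down_lt i hi u hu⟩
    · obtain ⟨e, rfl⟩ := Nat.exists_eq_add_of_le' hi
      have hrec : fgrade n e ≤ W.comap (carE fx) := by
        refine ih e (by omega) _ fun q b hqb hle h hh => ?_
        rw [Submodule.mem_comap, ← Module.End.mul_apply, ← pow_succ']
        rcases Nat.lt_or_ge n (q + (b + 1)) with h1 | h1
        · rw [pow_Hf_eq_zero (by omega) (by omega) hh]; exact zero_mem _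
        · exact hW q (b + 1) (by omega) h1 h hh
      rcases le_or_gt (e + 2) n with he | he
      · obtain ⟨h, hh, hh0, p', hp', rfl⟩ := isLadder_fermion.exists_harmonic_add e
          (fun j hj => by
            have : (j : ℝ) < n := by exact_mod_cast (show j < n by omega)
            linarith) u hu
        exact add_mem (hW (e + 2) 0 (by omega) (by omega) h ⟨hh, hh0⟩) (hrec hp')
      · obtain ⟨p', hp', rfl⟩ := isLadder_fermion.exists_raise (2 * n)
          (fun j => fgrade_eq_bot j) e
          (fun j hj => by
            have : (n : ℝ) < j := by exact_mod_cast (show n < j by omega)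
            linarith) u hu
        exact hrec hp'

theorem IsLadder.neg {M : Type*} [AddCommGroup M] [Module ℝ M] {E F : Module.End ℝ M}
    {G : ℕ → Submodule ℝ M} {c : ℕ → ℝ} (h : IsLadder E F G c) :
    IsLadder (-E) F G fun d => - c d where
  comm d u hu := by
    simp only [LinearMap.neg_apply, map_neg, h.comm d u hu]
    rw [neg_smul]; abel
  up d u hu := neg_mem (h.up d u hu)
  down := h.down
  down_lt := h.down_lt

theorem lapB_apply (p : MvPolynomial (Fin m) ℝ) :
    lapB m p = - ∑ j, pderiv j (pderiv j p) := by
  simp [lapB, LinearMap.sum_apply]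

theorem pderiv_rb2 (i : Fin m) : pderiv i (rb2 m) = - (2 * X i) := by
  simp only [rb2, map_neg, map_sum, Derivation.leibniz_pow, pderiv_X]
  rw [Finset.sum_eq_single i (fun j _ hj => by simp [hj.symm]) (by simp)]
  simp [two_mul]

theorem lapB_rb2_mul (d : ℕ) (p : MvPolynomial (Fin m) ℝ) (hp : p.IsHomogeneous d) :
    lapB m (rb2 m * p) = rb2 m * lapB m p + (4 * (d : ℝ) + 2 * m) • p := by
  have h1 : ∀ i, pderiv i (pderiv i (rb2 m * p)) =
      rb2 m * pderiv i (pderiv i p) - (4 : ℝ) • (X i * pderiv i p) - (2 : ℝ) • p := by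
    intro i
    have e2 : pderiv i (2 : MvPolynomial (Fin m) ℝ) = 0 := by
      rw [show (2 : MvPolynomial (Fin m) ℝ) = C 2 from (map_ofNat C 2).symm, pderiv_C]
    rw [Derivation.leibniz, pderiv_rb2]
    simp only [smul_eq_mul, map_add, map_neg, Derivation.leibniz, pderiv_rb2, pderiv_X_self, e2,
      smul_eq_C_mul, map_ofNat]
    ring
  rw [lapB_apply, lapB_apply, Finset.sum_congr rfl fun i _ => h1 i, Finset.sum_sub_distrib,
    Finset.sum_sub_distrib, ← Finset.smul_sum, hp.sum_X_mul_pderiv, ← Finset.mul_sum]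
  simp only [Finset.sum_const, Finset.card_univ, Fintype.card_fin, ← Nat.cast_smul_eq_nsmul ℝ,
    mul_neg]
  module

theorem pderiv_isHomogeneous_zero (i : Fin m) {p : MvPolynomial (Fin m) ℝ}
    (hp : p.IsHomogeneous 0) : pderiv i p = 0 := by
  rw [← mem_homogeneousSubmodule, homogeneousSubmodule_zero, Submodule.mem_one] at hp
  obtain ⟨r, rfl⟩ := hp
  exact pderiv_C

theorem isHomogeneous_rb2 : (rb2 m).IsHomogeneous 2 := by
  have : (rb2 m) ∈ homogeneousSubmodule (Fin m) ℝ 2 :=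
    neg_mem (sum_mem fun i _ => isHomogeneous_X_pow i 2)
  exact this

theorem isLadder_boson : IsLadder (LinearMap.mulLeft ℝ (rb2 m)) (lapB m)
    (homogeneousSubmodule (Fin m) ℝ) fun d => 4 * (d : ℝ) + 2 * m where
  comm d u hu := lapB_rb2_mul d u hu
  up d u hu := by
    have := isHomogeneous_rb2.mul ((mem_homogeneousSubmodule _ _).1 hu)
    rwa [add_comm 2 d] at this
  down d u hu := by
    rw [lapB_apply]
    refine neg_mem (sum_mem fun i _ => ?_)
    exact ((((mem_homogeneousSubmodule _ _).1 hu).pderiv (i := i)).pderiv (i := i))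
  down_lt d hd u hu := by
    rw [lapB_apply]
    refine neg_eq_zero.2 (Finset.sum_eq_zero fun i _ => ?_)
    refine pderiv_isHomogeneous_zero i ?_
    have := ((mem_homogeneousSubmodule _ _).1 hu).pderiv (i := i)
    rwa [show d - 1 = 0 by omega] at this

instance homogeneousSubmodule_finite (d : ℕ) :
    FiniteDimensional ℝ (homogeneousSubmodule (Fin m) ℝ d) :=
  Module.Finite.iff_fg.2 (homogeneousSubmodule_fg ..)

theorem lapB_pow {p : ℕ} {u : MvPolynomial (Fin m) ℝ} (hu : u ∈ Hb m p) (a : ℕ) :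
    lapB m (rb2 m ^ (a + 1) * u) =
      (4 * ((a : ℝ) + 1) * (p + (m : ℝ) / 2 + a)) • (rb2 m ^ a * u) := by
  have := isLadder_boson.lower_pow p u hu.1 hu.2 (fun a => 4 * (a : ℝ) * (p + (m : ℝ) / 2 + a - 1))
    (by simp) (fun a => by push_cast; ring) a
  simp only [LinearMap.pow_mulLeft, LinearMap.mulLeft_apply] at this
  rw [this]
  congr 1; push_cast; ring

theorem exists_harmonic_add_rb2_mul (hm : 1 ≤ m) (d : ℕ) (p : MvPolynomial (Fin m) ℝ)
    (hp : p ∈ homogeneousSubmodule (Fin m) ℝ d) : ∃ h ∈ Hb m d, ∃ p', p = h + rb2 m * p' := by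
  rcases lt_or_ge d 2 with hd | hd
  · exact ⟨p, ⟨hp, isLadder_boson.down_lt d hd p hp⟩, 0, by simp⟩
  · obtain ⟨e, rfl⟩ := Nat.exists_eq_add_of_le' hd
    have hm' : (1 : ℝ) ≤ m := by exact_mod_cast hm
    obtain ⟨h, hh, hh0, p', -, rfl⟩ := isLadder_boson.neg.exists_harmonic_add e
      (fun j _ => by have := Nat.cast_nonneg (α := ℝ) j; linarith) p hp
    exact ⟨h, ⟨hh, hh0⟩, -p', by simp⟩

theorem lapB_rb2_injective (hm : 1 ≤ m) :
    Function.Injective (lapB m ∘ₗ LinearMap.mulLeft ℝ (rb2 m)) := by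
  rw [← LinearMap.ker_eq_bot, LinearMap.ker_eq_bot']
  intro p hp
  have hm' : (1 : ℝ) ≤ m := by exact_mod_cast hm
  set T := lapB m ∘ₗ LinearMap.mulLeft ℝ (rb2 m) with hT
  have hTd : ∀ d, ∀ u ∈ homogeneousSubmodule (Fin m) ℝ d, T u ∈ homogeneousSubmodule (Fin m) ℝ d :=
    fun d u hu => isLadder_boson.down d _ (isLadder_boson.up d u hu)
  have hcomp : ∀ d, T (homogeneousComponent d p) = homogeneousComponent d (T p) := by
    intro d
    conv_rhs => rw [← sum_homogeneousComponent p]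
    rw [map_sum, map_sum, Finset.sum_congr rfl fun i _ => homogeneousComponent_of_mem
      (hTd i _ (homogeneousComponent_mem i p))]
    rw [Finset.sum_ite_eq]
    split_ifs with h
    · rfl
    · rw [homogeneousComponent_eq_zero _ _ (by simpa using h), map_zero]
  rw [← sum_homogeneousComponent p]
  refine Finset.sum_eq_zero fun d _ => ?_
  refine isLadder_boson.neg.eq_zero_of_lower_raise d
    (fun j _ => by have := Nat.cast_nonneg (α := ℝ) j; linarith) _ (homogeneousComponent_mem d p) 0
    le_rfl ?_
  have h := hcomp d
  rw [hp, map_zero] at h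
  rw [LinearMap.neg_apply, map_neg, zero_smul, neg_eq_zero]
  exact h

/-- The coefficients of `fkpq`. -/
def fcoef (m n k p q i : ℕ) : ℝ :=
  (Nat.choose k i : ℝ) * ((n - q - i).factorial : ℝ) / Real.Gamma ((m:ℝ)/2 + p + k - i)

theorem fkpq_mul_tmul (k p q : ℕ) (h : MvPolynomial (Fin m) ℝ) (w : Grass n) :
    fkpq m n k p q * h ⊗ₜ w = ∑ i ∈ Finset.range (k + 1),
      fcoef m n k p q i • ((rb2 m ^ (k - i) * h) ⊗ₜ[ℝ] (carE fx ^ i) w) := by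
  rw [fkpq, Finset.sum_mul]
  refine Finset.sum_congr rfl fun i _ => ?_
  rw [smul_mul_assoc, Algebra.TensorProduct.tmul_mul_tmul, ← mulLeft_rf2, LinearMap.pow_mulLeft]
  rfl

theorem lap_tmul (h : MvPolynomial (Fin m) ℝ) (w : Grass n) :
    lap m n (h ⊗ₜ w) = lapB m h ⊗ₜ w + h ⊗ₜ lapF n w := by
  simp [lap]

theorem Gamma_arg_pos (hm : 1 ≤ m) {k i : ℕ} (p : ℕ) (hi : i ≤ k) :
    0 < (m:ℝ)/2 + p + k - i := by
  have h1 : (1 : ℝ) ≤ m := by exact_mod_cast hm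
  have h2 : (i : ℝ) ≤ k := by exact_mod_cast hi
  have h3 : (0 : ℝ) ≤ p := Nat.cast_nonneg p
  linarith

theorem fcoef_ne_zero (hm : 1 ≤ m) {k i : ℕ} (p q : ℕ) (hi : i ≤ k) : fcoef m n k p q i ≠ 0 := by
  refine div_ne_zero (mul_ne_zero ?_ ?_) (Real.Gamma_pos_of_pos (Gamma_arg_pos hm p hi)).ne'
  · exact_mod_cast (Nat.choose_pos hi).ne'
  · exact_mod_cast Nat.factorial_ne_zero _

theorem fcoef_rec (hm : 1 ≤ m) {k p q i : ℕ} (hi : i < k) (hk : k ≤ n - q) :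
    fcoef m n k p q i * (((k - i - 1 : ℕ) + 1 : ℝ) * (p + (m : ℝ) / 2 + (k - i - 1 : ℕ))) +
      fcoef m n k p q (i + 1) * (((i : ℝ) + 1) * (q + i - n)) = 0 := by
  obtain ⟨e, rfl⟩ := Nat.exists_eq_add_of_lt hi
  obtain ⟨f, hf⟩ := Nat.exists_eq_add_of_le (show q + (i + 1) ≤ n by omega)
  have hpos := Gamma_arg_pos hm p (show i + 1 ≤ i + e + 1 by omega)
  have hG : Real.Gamma ((m:ℝ)/2 + p + (i + e + 1 : ℕ) - i) =
      ((m:ℝ)/2 + p + (i + e + 1 : ℕ) - (i + 1 : ℕ)) *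
        Real.Gamma ((m:ℝ)/2 + p + (i + e + 1 : ℕ) - (i + 1 : ℕ)) := by
    rw [← Real.Gamma_add_one hpos.ne']
    congr 1; push_cast; ring
  have hC : (((i + e + 1).choose (i + 1) : ℕ) : ℝ) * (i + 1) =
      ((i + e + 1).choose i : ℕ) * (e + 1) := by
    have := Nat.choose_succ_right_eq (i + e + 1) i
    rw [show i + e + 1 - i = e + 1 by omega] at this
    exact_mod_cast this
  have hG0 := (Real.Gamma_pos_of_pos hpos).ne'
  rw [fcoef, fcoef, hG, show n - q - i = f + 1 by omega, show n - q - (i + 1) = f by omega,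
    show i + e + 1 - i - 1 = e by omega, Nat.factorial_succ]
  have hn : (n : ℝ) = q + (i + 1) + f := by rw [hf]; push_cast; ring
  set Γ := Real.Gamma ((m:ℝ)/2 + p + (i + e + 1 : ℕ) - (i + 1 : ℕ))
  have hr : (m:ℝ)/2 + p + (i + e + 1 : ℕ) - (i + 1 : ℕ) = p + (m : ℝ) / 2 + e := by
    push_cast; ring
  rw [hr] at hpos ⊢
  rw [hn]
  have hpos' := hpos.ne'
  rw [div_mul_eq_mul_div, div_mul_eq_mul_div, div_add_div _ _ (mul_ne_zero hpos' hG0) hG0,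
    div_eq_zero_iff]
  left
  push_cast
  linear_combination (-(f.factorial : ℝ) * (f + 1) * Γ * (p + (m : ℝ) / 2 + e)) * hC

theorem HbHf_le_P {p q k : ℕ} (h : p + q = k) : HbHf m n p q ≤ P m n k := by
  refine (Submodule.map₂_le_map₂ (inf_le_left) (inf_le_left)).trans ?_
  subst h
  refine le_trans (le_of_eq ?_) (le_iSup _ (⟨q, by omega⟩ : Fin (p + q + 1)))
  simp

theorem tmul_mem_P {a b k : ℕ} (h : a + b = k) {u : MvPolynomial (Fin m) ℝ} {w : Grass n}
    (hu : u ∈ homogeneousSubmodule (Fin m) ℝ a) (hw : w ∈ fgrade n b) : u ⊗ₜ w ∈ P m n k := by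
  subst h
  refine Submodule.mem_iSup_of_mem (⟨b, by omega⟩ : Fin (a + b + 1)) ?_
  exact Submodule.apply_mem_map₂ _ (by simpa using hu) hw

theorem HbHf_le_ker (p q : ℕ) : HbHf m n p q ≤ LinearMap.ker (lap m n) := by
  refine Submodule.map₂_le.2 fun h hh w hw => ?_
  show lap m n (h ⊗ₜ w) = 0
  rw [lap_tmul, show lapB m h = 0 from hh.2, show lapF n w = 0 from hw.2]
  simp

theorem map_fkpq_le_P {l p q k : ℕ} (h : p + q + 2 * l = k) :
    (HbHf m n p q).map (LinearMap.mulLeft ℝ (fkpq m n l p q)) ≤ P m n k := by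
  rw [Submodule.map_le_iff_le_comap]
  refine Submodule.map₂_le.2 fun u hu w hw => ?_
  show fkpq m n l p q * u ⊗ₜ w ∈ P m n k
  rw [fkpq_mul_tmul]
  refine sum_mem fun i hi => Submodule.smul_mem _ _ ?_
  have hi := Finset.mem_range_succ_iff.1 hi
  refine tmul_mem_P (a := p + 2 * (l - i)) (b := q + 2 * i) (by omega) ?_
    (isLadder_fermion.pow_mem q i w hw.1)
  have := isLadder_boson.pow_mem p (l - i) u hu.1
  rwa [LinearMap.pow_mulLeft] at this

theorem map_fkpq_le_ker (hm : 1 ≤ m) {l p q : ℕ} (hl : l ≤ n - q) :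
    (HbHf m n p q).map (LinearMap.mulLeft ℝ (fkpq m n l p q)) ≤ LinearMap.ker (lap m n) := by
  rw [Submodule.map_le_iff_le_comap]
  refine Submodule.map₂_le.2 fun u hu w hw => ?_
  show lap m n (fkpq m n l p q * u ⊗ₜ w) = 0
  rw [fkpq_mul_tmul, map_sum]
  simp only [map_smul, lap_tmul, smul_add, Finset.sum_add_distrib]
  rw [Finset.sum_range_succ, Finset.sum_range_succ' (fun i => fcoef m n l p q i •
    (rb2 m ^ (l - i) * u) ⊗ₜ[ℝ] lapF n ((carE fx ^ i) w))]
  have h1 : lapB m (rb2 m ^ (l - l) * u) = 0 := by simpa using hu.2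
  have h2 : lapF n ((carE fx ^ 0) w) = 0 := by simpa using hw.2
  rw [h1, h2, TensorProduct.zero_tmul, TensorProduct.tmul_zero, smul_zero, smul_zero, add_zero,
    add_zero, ← Finset.sum_add_distrib]
  refine Finset.sum_eq_zero fun i hi => ?_
  have hi := Finset.mem_range.1 hi
  have e1 := lapB_pow hu (l - i - 1)
  rw [show l - i - 1 + 1 = l - i by omega] at e1
  rw [e1, lapF_pow hw, show l - (i + 1) = l - i - 1 by omega, ← TensorProduct.smul_tmul',
    TensorProduct.tmul_smul, smul_smul, smul_smul, ← add_smul]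
  have := fcoef_rec (p := p) hm hi hl
  rw [show ∀ a b c d e f : ℝ, a * (4 * b * c) + d * (4 * e * f) = 4 * (a * (b * c) + d * (e * f)) by
    intros; ring, this, mul_zero, zero_smul]

theorem decompPiece_le_H (hm : 1 ≤ m) (k : ℕ) (idx : decompIdx n k) :
    decompPiece m n k idx ≤ H m n k := by
  rcases idx with i | ⟨j, l⟩
  · have := i.2
    exact le_inf (HbHf_le_P (by omega)) (HbHf_le_ker _ _)
  · have h1 := j.2
    have h2 := l.2
    refine le_inf (map_fkpq_le_P ?_) (map_fkpq_le_ker hm ?_)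
    · omega
    · omega

theorem isNilpotent_lapF : IsNilpotent (lapF n) := by
  rw [lapF_eq]
  refine IsNilpotent.smul ?_ _
  have hc : ∀ i j : Fin n, Commute (fd (.inl i) * fd (.inr i) : Module.End ℝ (Grass n))
      (fd (.inl j) * fd (.inr j)) := by
    intro i j
    refine LinearMap.ext fun u => ?_
    simp only [Module.End.mul_apply]
    rw [isCAR_fermion.dd (.inr i) (.inl j), isCAR_fermion.dd (.inr i) (.inr j), map_neg,
      isCAR_fermion.dd (.inl i) (.inl j), map_neg, map_neg, isCAR_fermion.dd (.inl i) (.inr j)]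
    simp only [map_neg, neg_neg]
  refine Commute.isNilpotent_sum (fun i _ => ⟨2, ?_⟩) (fun i j _ _ => hc i j)
  refine LinearMap.ext fun u => ?_
  rw [pow_two]
  simp only [Module.End.mul_apply]
  rw [isCAR_fermion.dd (.inr i) (.inl i), isCAR_fermion.dd_self]
  simp

theorem lap_rb2_mul_injective (hm : 1 ≤ m) (u : SuperPoly m n)
    (hu : lap m n (LinearMap.rTensor (Grass n) (LinearMap.mulLeft ℝ (rb2 m)) u) = 0) : u = 0 := by
  set B := LinearMap.rTensor (Grass n) (LinearMap.mulLeft ℝ (rb2 m)) with hB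
  set T : Module.End ℝ (SuperPoly m n) :=
    LinearMap.lTensor (MvPolynomial (Fin m) ℝ) (lapF n) with hT
  set G := LinearMap.rTensor (Grass n) (lapB m ∘ₗ LinearMap.mulLeft ℝ (rb2 m)) with hG
  have hGi : Function.Injective G :=
    Module.Flat.rTensor_preserves_injective_linearMap _ (lapB_rb2_injective hm)
  have hTB : ∀ v, T (B v) = B (T v) := fun v => by
    rw [hT, hB, ← LinearMap.comp_apply, ← LinearMap.comp_apply, LinearMap.lTensor_comp_rTensor,
      LinearMap.rTensor_comp_lTensor]
  have hTG : ∀ v, T (G v) = G (T v) := fun v => by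
    rw [hT, hG, ← LinearMap.comp_apply, ← LinearMap.comp_apply, LinearMap.lTensor_comp_rTensor,
      LinearMap.rTensor_comp_lTensor]
  have hTGk : ∀ k v, (T ^ k) (G v) = G ((T ^ k) v) := fun k v => by
    induction k with
    | zero => simp
    | succ k ih => rw [pow_succ', Module.End.mul_apply, ih, hTG, Module.End.mul_apply]
  have hTBk : ∀ k v, (T ^ k) (B v) = B ((T ^ k) v) := fun k v => by
    induction k with
    | zero => simp
    | succ k ih => rw [pow_succ', Module.End.mul_apply, ih, hTB, Module.End.mul_apply]
  have h1 : G u = - B (T u) := by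
    rw [lap, LinearMap.add_apply] at hu
    have : G u = LinearMap.rTensor (Grass n) (lapB m) (B u) := by
      rw [hG, LinearMap.rTensor_comp, LinearMap.comp_apply]
    rw [this, ← hTB]
    exact eq_neg_of_add_eq_zero_left hu
  obtain ⟨K, hK⟩ := isNilpotent_lapF (n := n)
  have hTK : T ^ K = 0 := by
    rw [hT]
    refine (LinearMap.lTensor_pow _ _).trans ?_
    rw [hK, LinearMap.lTensor_zero]
  have hdesc : ∀ k, (T ^ k) u = 0 → u = 0 := by
    intro k
    induction k with
    | zero => intro h; simpa using h
    | succ k ih =>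
      intro h
      apply ih
      apply hGi
      rw [pow_succ, Module.End.mul_apply] at h
      rw [← hTGk, h1, map_neg, hTBk, h]
      simp
  exact hdesc K (by rw [hTK]; rfl)

theorem P_le (hm : 1 ≤ m) (hn : 1 ≤ n) (k : ℕ) : P m n k ≤ (⨆ idx, decompPiece m n k idx) ⊔
    LinearMap.range (LinearMap.rTensor (Grass n) (LinearMap.mulLeft ℝ (rb2 m))) := by
  set S := (⨆ idx, decompPiece m n k idx) ⊔
    LinearMap.range (LinearMap.rTensor (Grass n) (LinearMap.mulLeft ℝ (rb2 m))) with hS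
  refine iSup_le fun i => Submodule.map₂_le.2 fun p hp w hw => ?_
  obtain ⟨h, hh, p', rfl⟩ := exists_harmonic_add_rb2_mul hm _ p hp
  rw [TensorProduct.mk_apply, TensorProduct.add_tmul]
  refine add_mem ?_ (Submodule.mem_sup_right ⟨p' ⊗ₜ w, by simp⟩)
  refine fgrade_le_of_pow_mem hn i.1 (Submodule.comap (TensorProduct.mk ℝ _ (Grass n) h) S)
    (fun q b hqb hle w hw => ?_) hw
  rw [Submodule.mem_comap, TensorProduct.mk_apply]
  have hi := i.2
  rcases Nat.eq_zero_or_pos b with rfl | hb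
  · refine Submodule.mem_sup_left (Submodule.mem_iSup_of_mem
      (Sum.inl ⟨q, by omega⟩ : decompIdx n k) ?_)
    rw [decompPiece]
    refine Submodule.apply_mem_map₂ _ ?_ (by simpa using hw)
    rwa [show k - q = k - i by omega]
  · obtain ⟨c, rfl⟩ := Nat.exists_eq_add_of_le' hb
    have h1 : fkpq m n (c + 1) (k - 2 * (c + 1) - q) q * h ⊗ₜ w ∈ S := by
      refine Submodule.mem_sup_left (Submodule.mem_iSup_of_mem
        (Sum.inr ⟨⟨q, by omega⟩, ⟨c, by simp only; omega⟩⟩ : decompIdx n k) ?_)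
      rw [decompPiece]
      refine Submodule.mem_map_of_mem (f := LinearMap.mulLeft ℝ _)
        (Submodule.apply_mem_map₂ _ ?_ hw)
      simp only
      rwa [show k - 2 * (c + 1) - q = k - i by omega]
    rw [fkpq_mul_tmul, Finset.sum_range_succ] at h1
    have h2 : ∀ i ∈ Finset.range (c + 1), fcoef m n (c + 1) (k - 2 * (c + 1) - q) q i •
        ((rb2 m ^ (c + 1 - i) * h) ⊗ₜ[ℝ] (carE fx ^ i) w) ∈ S := by
      intro i hi
      have hi := Finset.mem_range.1 hi
      refine Submodule.smul_mem _ _ (Submodule.mem_sup_right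
        ⟨(rb2 m ^ (c - i) * h) ⊗ₜ (carE fx ^ i) w, ?_⟩)
      rw [LinearMap.rTensor_tmul, LinearMap.mulLeft_apply, ← mul_assoc, ← pow_succ',
        show c - i + 1 = c + 1 - i by omega]
    have h3 := (Submodule.add_mem_iff_right S (sum_mem h2)).1 h1
    rw [Submodule.smul_mem_iff _ (fcoef_ne_zero hm _ _ le_rfl)] at h3
    simpa using h3

theorem H_eq_iSup (hm : 1 ≤ m) (hn : 1 ≤ n) (k : ℕ) :
    H m n k = ⨆ idx : decompIdx n k, decompPiece m n k idx := by
  refine le_antisymm (fun u hu => ?_) (iSup_le fun idx => decompPiece_le_H hm k idx)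
  obtain ⟨y, hy, z, ⟨v, rfl⟩, rfl⟩ := Submodule.mem_sup.1 (P_le hm hn k hu.1)
  have hy' : y ∈ H m n k := (iSup_le fun idx => decompPiece_le_H hm k idx) hy
  have h1 : lap m n (LinearMap.rTensor (Grass n) (LinearMap.mulLeft ℝ (rb2 m)) v) = 0 := by
    have h2 : lap m n (y + LinearMap.rTensor (Grass n) (LinearMap.mulLeft ℝ (rb2 m)) v) = 0 := hu.2
    rwa [map_add, show lap m n y = 0 from hy'.2, zero_add] at h2
  rw [lap_rb2_mul_injective hm v h1, map_zero, add_zero]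
  exact hy

/-- The Euler operator. -/
def euler (m : ℕ) : Module.End ℝ (MvPolynomial (Fin m) ℝ) :=
  ∑ i, LinearMap.mulLeft ℝ (X i) * (pderiv i).toLinearMap

/-- The bosonic Casimir operator. -/
def casB (m : ℕ) : Module.End ℝ (MvPolynomial (Fin m) ℝ) :=
  euler m * euler m + ((m : ℝ) - 2) • euler m - LinearMap.mulLeft ℝ (rb2 m) * lapB m

/-- The fermionic Casimir operator. -/
def casF (n : ℕ) : Module.End ℝ (Grass n) :=
  (∑ c, fx c * fd c) * (∑ c, fx c * fd c) - (2 * (n : ℝ) + 2) • (∑ c, fx c * fd c) -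
    carE fx * lapF n

theorem euler_apply {d : ℕ} {p : MvPolynomial (Fin m) ℝ} (hp : p.IsHomogeneous d) :
    euler m p = (d : ℝ) • p := by
  have := hp.sum_X_mul_pderiv
  rw [← Nat.cast_smul_eq_nsmul ℝ] at this
  simpa [euler, LinearMap.sum_apply] using this

theorem casB_pow {p : ℕ} {h : MvPolynomial (Fin m) ℝ} (hh : h ∈ Hb m p) (a : ℕ) :
    casB m (rb2 m ^ a * h) = ((p : ℝ) * (p + m - 2)) • (rb2 m ^ a * h) := by
  have hd : (rb2 m ^ a * h).IsHomogeneous (p + 2 * a) := by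
    have := isLadder_boson.pow_mem p a h hh.1
    rwa [LinearMap.pow_mulLeft] at this
  have h1 : rb2 m * lapB m (rb2 m ^ a * h) =
      (4 * (a : ℝ) * (p + (m : ℝ) / 2 + a - 1)) • (rb2 m ^ a * h) := by
    rcases a with _ | a
    · have : lapB m h = 0 := hh.2
      simp [this]
    · rw [lapB_pow hh, mul_smul_comm, ← mul_assoc, ← pow_succ']
      congr 1; push_cast; ring
  simp only [casB, LinearMap.sub_apply, LinearMap.add_apply, Module.End.mul_apply,
    LinearMap.smul_apply, euler_apply hd, map_smul, LinearMap.mulLeft_apply, h1]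
  push_cast
  module

theorem casF_pow {q : ℕ} {w : Grass n} (hw : w ∈ Hf n q) (b : ℕ) :
    casF n ((carE fx ^ b) w) = ((q : ℝ) * (q - 2 * n - 2)) • (carE fx ^ b) w := by
  have hd := number_fermion _ _ (isLadder_fermion.pow_mem q b w hw.1)
  have h1 : carE fx (lapF n ((carE fx ^ b) w)) =
      (4 * (b : ℝ) * (q + b - 1 - n)) • (carE fx ^ b) w := by
    rcases b with _ | b
    · have : lapF n w = 0 := hw.2
      simp [this]
    · rw [lapF_pow hw, map_smul, ← Module.End.mul_apply, ← pow_succ']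
      congr 1; push_cast; ring
  have h2 : (∑ c, fx c * fd c) ((carE fx ^ b) w) = ((q + 2 * b : ℕ) : ℝ) • (carE fx ^ b) w := by
    rw [← hd]; simp [LinearMap.sum_apply]
  simp only [casF, LinearMap.sub_apply, Module.End.mul_apply,
    LinearMap.smul_apply, h1]
  rw [h2]
  simp only [map_smul, h2]
  push_cast
  module

/-- A combination of the two Casimir operators that separates the summands. -/
def cas (m n : ℕ) : Module.End ℝ (SuperPoly m n) :=
  LinearMap.rTensor (Grass n) (casB m) +
    √2 • LinearMap.lTensor (MvPolynomial (Fin m) ℝ) (casF n)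

/-- The eigenvalue of `cas` on the summand with parameters `p`, `q`. -/
def casVal (m n p q : ℕ) : ℝ := (p : ℝ) * (p + m - 2) + √2 * ((q : ℝ) * (q - 2 * n - 2))

theorem cas_tmul {p q : ℕ} {h : MvPolynomial (Fin m) ℝ} {w : Grass n} (hh : h ∈ Hb m p)
    (hw : w ∈ Hf n q) (a b : ℕ) : cas m n ((rb2 m ^ a * h) ⊗ₜ (carE fx ^ b) w) =
      casVal m n p q • ((rb2 m ^ a * h) ⊗ₜ (carE fx ^ b) w) := by
  rw [cas, LinearMap.add_apply, LinearMap.smul_apply, LinearMap.rTensor_tmul,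
    LinearMap.lTensor_tmul, casB_pow hh, casF_pow hw, casVal, ← TensorProduct.smul_tmul',
    TensorProduct.tmul_smul, smul_smul, add_smul]

theorem HbHf_le_eigenspace (p q : ℕ) : HbHf m n p q ≤ (cas m n).eigenspace (casVal m n p q) := by
  refine Submodule.map₂_le.2 fun h hh w hw => ?_
  rw [Module.End.mem_eigenspace_iff]
  simpa using cas_tmul hh hw 0 0

theorem map_fkpq_le_eigenspace (l p q : ℕ) :
    (HbHf m n p q).map (LinearMap.mulLeft ℝ (fkpq m n l p q)) ≤
      (cas m n).eigenspace (casVal m n p q) := by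
  rw [Submodule.map_le_iff_le_comap]
  refine Submodule.map₂_le.2 fun h hh w hw => ?_
  show fkpq m n l p q * h ⊗ₜ w ∈ (cas m n).eigenspace (casVal m n p q)
  rw [fkpq_mul_tmul]
  refine sum_mem fun i _ => Submodule.smul_mem _ _ ?_
  rw [Module.End.mem_eigenspace_iff]
  exact cas_tmul hh hw _ _

/-- The parameters `(p, q)` of a summand. -/
def pieceDeg (n k : ℕ) : decompIdx n k → ℕ × ℕ
  | .inl i => (k - i.1, i.1)
  | .inr ⟨j, l⟩ => (k - 2 * (l.1 + 1) - j.1, j.1)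

theorem casVal_injective (hm : 1 ≤ m) {p p' q q' : ℕ} (hq : q ≤ n) (hq' : q' ≤ n)
    (hp : (p + q) % 2 = (p' + q') % 2) (h : casVal m n p q = casVal m n p' q') :
    p = p' ∧ q = q' := by
  have key : ∀ a b : ℤ, (a : ℝ) + √2 * b = 0 → b = 0 ∧ a = 0 := by
    intro a b hab
    have hb : b = 0 := by
      by_contra hb
      have hb' : (b : ℝ) ≠ 0 := by exact_mod_cast hb
      refine irrational_sqrt_two ⟨-a / b, ?_⟩
      push_cast
      rw [div_eq_iff hb']; linarith
    subst hb
    simpa using hab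
  obtain ⟨h1, h2⟩ := key ((p : ℤ) * (p + m - 2) - p' * (p' + m - 2))
    ((q : ℤ) * (q - 2 * n - 2) - q' * (q' - 2 * n - 2)) (by
      simp only [casVal] at h
      push_cast
      linear_combination h)
  have h3 : ((q : ℤ) - q') * (q + q' - 2 * n - 2) = 0 := by linear_combination h1
  have hqq : q = q' := by
    rcases mul_eq_zero.1 h3 with h | h <;> omega
  have h4 : ((p : ℤ) - p') * (p + p' + m - 2) = 0 := by linear_combination h2
  refine ⟨?_, hqq⟩
  rcases mul_eq_zero.1 h4 with h | h <;> omega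

theorem iSupIndep_decompPiece (hm : 1 ≤ m) (k : ℕ) : iSupIndep (decompPiece m n k) := by
  have hinj : Function.Injective fun idx : decompIdx n k =>
      casVal m n (pieceDeg n k idx).1 (pieceDeg n k idx).2 := by
    rintro (i | ⟨j, l⟩) (i' | ⟨j', l'⟩) h
    · have h1 := i.2
      have h2 := i'.2
      have := (casVal_injective hm (by simp only [pieceDeg]; omega)
        (by simp only [pieceDeg]; omega) (by simp only [pieceDeg]; omega) h).2
      exact congrArg Sum.inl (Fin.ext this)
    · have h1 := i.2
      have h2 := j'.2
      have h3 := l'.2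
      obtain ⟨h4, h5⟩ := casVal_injective hm (by simp only [pieceDeg]; omega)
        (by simp only [pieceDeg]; omega) (by simp only [pieceDeg]; omega) h
      simp only [pieceDeg] at h4 h5
      omega
    · have h1 := i'.2
      have h2 := j.2
      have h3 := l.2
      obtain ⟨h4, h5⟩ := casVal_injective hm (by simp only [pieceDeg]; omega)
        (by simp only [pieceDeg]; omega) (by simp only [pieceDeg]; omega) h
      simp only [pieceDeg] at h4 h5
      omega
    · have h1 := j.2
      have h2 := j'.2
      have h3 := l.2
      have h4 := l'.2
      obtain ⟨h5, h6⟩ := casVal_injective hm (by simp only [pieceDeg]; omega)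
        (by simp only [pieceDeg]; omega) (by simp only [pieceDeg]; omega) h
      simp only [pieceDeg] at h5 h6
      obtain rfl := Fin.ext h6
      obtain rfl : l = l' := Fin.ext (by omega)
      rfl
  refine ((Module.End.eigenspaces_iSupIndep (cas m n)).comp hinj).mono fun idx => ?_
  rcases idx with i | ⟨j, l⟩
  · exact HbHf_le_eigenspace _ _
  · exact map_fkpq_le_eigenspace _ _ _

/-- The linear substitution of the bosonic variables. -/
def substB (A : Matrix (Fin m) (Fin m) ℝ) : MvPolynomial (Fin m) ℝ →ₐ[ℝ] MvPolynomial (Fin m) ℝ :=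
  aeval (fun j : Fin m => ∑ i : Fin m, A j i • (X i : MvPolynomial (Fin m) ℝ))

/-- The linear substitution of the fermionic variables. -/
def substF (D : Matrix (Fin (2 * n)) (Fin (2 * n)) ℝ) : Grass n →ₐ[ℝ] Grass n :=
  ExteriorAlgebra.map (Matrix.toLin' D)

theorem act_tmul (A : Matrix (Fin m) (Fin m) ℝ) (D : Matrix (Fin (2 * n)) (Fin (2 * n)) ℝ)
    (p : MvPolynomial (Fin m) ℝ) (w : Grass n) :
    act m n A D (p ⊗ₜ w) = substB A p ⊗ₜ substF D w := rfl

theorem substB_X (A : Matrix (Fin m) (Fin m) ℝ) (j : Fin m) :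
    substB A (X j) = ∑ i : Fin m, A j i • (X i : MvPolynomial (Fin m) ℝ) := aeval_X _ _

theorem pderiv_substB (A : Matrix (Fin m) (Fin m) ℝ) (i : Fin m) (p : MvPolynomial (Fin m) ℝ) :
    pderiv i (substB A p) = ∑ j, A j i • substB A (pderiv j p) := by
  induction p using MvPolynomial.induction_on with
  | C r => simp [substB]
  | add p q hp hq => simp only [map_add, hp, hq, smul_add, Finset.sum_add_distrib]
  | mul_X p k hp =>
    have h1 : pderiv i (substB A (X k)) = C (A k i) := by
      simp [substB_X, pderiv_X, Pi.single_apply, MvPolynomial.smul_eq_C_mul]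
    have h2 : ∀ j, A j i • substB A (pderiv j (p * X k)) =
        substB A (X k) * (A j i • substB A (pderiv j p)) +
          if j = k then A k i • substB A p else 0 := by
      intro j
      rw [Derivation.leibniz, pderiv_X]
      by_cases hjk : j = k
      · subst hjk
        simp [smul_add, add_comm]
      · simp [hjk, Ne.symm hjk]
    rw [map_mul, Derivation.leibniz, h1, hp, Finset.sum_congr rfl fun j _ => h2 j,
      Finset.sum_add_distrib, ← Finset.mul_sum]
    simp [MvPolynomial.smul_eq_C_mul, add_comm, mul_comm]

theorem lapB_substB {A : Matrix (Fin m) (Fin m) ℝ} (hA : A * Aᵀ = 1) (p : MvPolynomial (Fin m) ℝ) :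
    lapB m (substB A p) = substB A (lapB m p) := by
  have h1 : ∀ j l, ∑ i, A j i * A l i = if j = l then 1 else 0 := by
    intro j l
    have := congrFun (congrFun hA j) l
    simpa [Matrix.mul_apply, Matrix.one_apply] using this
  have h2 : ∀ i, pderiv i (pderiv i (substB A p)) =
      ∑ j, ∑ l, (A j i * A l i) • substB A (pderiv l (pderiv j p)) := by
    intro i
    rw [pderiv_substB, map_sum]
    refine Finset.sum_congr rfl fun j _ => ?_
    rw [Derivation.map_smul, pderiv_substB, Finset.smul_sum]
    simp only [smul_smul]
  simp only [lapB_apply, h2, map_neg, map_sum]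
  congr 1
  rw [Finset.sum_comm]
  refine Finset.sum_congr rfl fun j _ => ?_
  rw [Finset.sum_comm]
  simp only [← Finset.sum_smul, h1]
  simp

theorem substB_rb2 {A : Matrix (Fin m) (Fin m) ℝ} (hA : Aᵀ * A = 1) :
    substB A (rb2 m) = rb2 m := by
  have h1 : ∀ j l, ∑ i, A i j * A i l = if j = l then 1 else 0 := by
    intro j l
    have := congrFun (congrFun hA j) l
    simpa [Matrix.mul_apply, Matrix.one_apply] using this
  simp only [rb2, map_neg, map_sum, pow_two, map_mul, substB_X, Finset.sum_mul_sum,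
    smul_mul_smul_comm]
  congr 1
  rw [Finset.sum_comm]
  refine Finset.sum_congr rfl fun j _ => ?_
  rw [Finset.sum_comm]
  simp only [← Finset.sum_smul, h1]
  simp

theorem substB_mem {A : Matrix (Fin m) (Fin m) ℝ} {d : ℕ} {p : MvPolynomial (Fin m) ℝ}
    (hp : p ∈ homogeneousSubmodule (Fin m) ℝ d) :
    substB A p ∈ homogeneousSubmodule (Fin m) ℝ d := by
  have h : ∀ j, (∑ i : Fin m, A j i • (X i : MvPolynomial (Fin m) ℝ)).IsHomogeneous 1 := fun j =>
    sum_mem (S := homogeneousSubmodule (Fin m) ℝ 1) fun i _ =>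
      Submodule.smul_mem _ _ (isHomogeneous_X ℝ i)
  have := ((mem_homogeneousSubmodule _ _).1 hp).aeval _ h
  rwa [one_mul] at this

theorem substB_mem_Hb {A : Matrix (Fin m) (Fin m) ℝ} (hA : A * Aᵀ = 1) {d : ℕ}
    {p : MvPolynomial (Fin m) ℝ} (hp : p ∈ Hb m d) : substB A p ∈ Hb m d := by
  refine ⟨substB_mem hp.1, ?_⟩
  show lapB m _ = 0
  rw [lapB_substB hA, show lapB m p = 0 from hp.2, map_zero]

theorem substF_ι (D : Matrix (Fin (2 * n)) (Fin (2 * n)) ℝ) (v : Fin (2 * n) → ℝ) :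
    substF D (ExteriorAlgebra.ι ℝ v) = ExteriorAlgebra.ι ℝ (D *ᵥ v) := by
  simp [substF]

theorem fpderiv_substF (D : Matrix (Fin (2 * n)) (Fin (2 * n)) ℝ) (i : Fin (2 * n)) (w : Grass n) :
    fpderiv n i (substF D w) = ∑ c, D i c • substF D (fpderiv n c w) := by
  induction w using CliffordAlgebra.left_induction with
  | algebraMap r =>
    simp only [Algebra.algebraMap_eq_smul_one, map_smul, map_one, fpderiv_one, smul_zero, map_zero,
      Finset.sum_const_zero]
  | add x y hx hy => simp only [map_add, hx, hy, smul_add, Finset.sum_add_distrib]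
  | ι_mul v x hx =>
    change fpderiv n i (substF D (ExteriorAlgebra.ι ℝ x * v)) =
      ∑ c, D i c • substF D (fpderiv n c (ExteriorAlgebra.ι ℝ x * v))
    simp only [map_mul, substF_ι, fpderiv_ι_mul, hx, map_sub, map_smul, smul_sub,
      Finset.sum_sub_distrib, smul_smul, ← Finset.sum_smul, Finset.mul_sum, mul_smul_comm]
    rfl

theorem Jmat_fidx (c c' : Fin n ⊕ Fin n) : Jmat n (fidx n c) (fidx n c') =
    match c, c' with
    | .inl i, .inr j => if i = j then 1 / 2 else 0
    | .inr i, .inl j => if i = j then -1 / 2 else 0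
    | _, _ => 0 := by
  rcases c with i | i <;> rcases c' with j | j <;> unfold Jmat <;> dsimp only <;> split_ifs <;>
    simp only [fidx, Fin.ext_iff] at * <;> first | rfl | omega

theorem sum_Jmat_row {M : Type*} [AddCommGroup M] [Module ℝ M] (c : Fin n ⊕ Fin n)
    (f : Fin (2 * n) → M) : ∑ b, Jmat n (fidx n c) b • f b =
      match c with
      | .inl i => (1 / 2 : ℝ) • f (fidx n (.inr i))
      | .inr i => (-1 / 2 : ℝ) • f (fidx n (.inl i)) := by
  rw [← sum_fidx, Fintype.sum_sum_type]
  rcases c with i | i <;> simp [Jmat_fidx, ite_smul]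

theorem sum_Jmat {M : Type*} [AddCommGroup M] [Module ℝ M] (f : Fin (2 * n) → Fin (2 * n) → M) :
    ∑ a, ∑ b, Jmat n a b • f a b =
      ∑ j : Fin n, ((1 / 2 : ℝ) • f (fidx n (.inl j)) (fidx n (.inr j)) +
      (-1 / 2 : ℝ) • f (fidx n (.inr j)) (fidx n (.inl j))) := by
  rw [← sum_fidx, Fintype.sum_sum_type]
  simp only [sum_Jmat_row, Finset.sum_add_distrib]

theorem Jmat_mul_self : Jmat n * Jmat n = (-1 / 4 : ℝ) • 1 := by
  ext a b
  obtain ⟨c, rfl⟩ := (fidx_bijective n).2 a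
  obtain ⟨c', rfl⟩ := (fidx_bijective n).2 b
  rw [Matrix.mul_apply]
  have := sum_Jmat_row c (fun b => Jmat n b (fidx n c'))
  simp only [smul_eq_mul] at this
  rw [this]
  simp only [Matrix.smul_apply, Matrix.one_apply, (fidx_injective n).eq_iff]
  rcases c with i | i <;> rcases c' with j | j <;> simp only [Jmat_fidx] <;>
    simp <;> norm_num

theorem lapF_eq_Jmat (w : Grass n) :
    lapF n w = (4 : ℝ) • ∑ a, ∑ b, Jmat n a b • fpderiv n a (fpderiv n b w) := by
  rw [sum_Jmat, lapF_eq, LinearMap.smul_apply, carE_apply]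
  congr 1
  refine Finset.sum_congr rfl fun j _ => ?_
  have := isCAR_fermion.dd (.inr j) (.inl j) w
  change fpderiv n (fidx n (.inr j)) (fpderiv n (fidx n (.inl j)) w) =
    - fpderiv n (fidx n (.inl j)) (fpderiv n (fidx n (.inr j)) w) at this
  rw [this]
  simp only [fd]
  module

theorem rf2_eq_Jmat : rf2 n = ∑ a, ∑ b, Jmat n a b • (fgen n a * fgen n b) := by
  rw [sum_Jmat]
  refine Finset.sum_congr rfl fun j _ => ?_
  have := ι_mul_swap (n := n) (Pi.single (fidx n (.inr j)) 1) (Pi.single (fidx n (.inl j)) 1)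
  change fgen n (fidx n (.inr j)) * fgen n (fidx n (.inl j)) =
    - (fgen n (fidx n (.inl j)) * fgen n (fidx n (.inr j))) at this
  rw [this]
  change fgen n (fidx n (.inl j)) * fgen n (fidx n (.inr j)) = _
  module

theorem sum_bilin_transform {M : Type*} [AddCommGroup M] [Module ℝ M] {ι : Type*} [Fintype ι]
    (J D K : Matrix ι ι ℝ) (h : Dᵀ * J * D = K) (f : ι → ι → M) :
    ∑ a, ∑ b, J a b • ∑ d, D b d • ∑ c, D a c • f c d = ∑ c, ∑ d, K c d • f c d := by
  have hK : ∀ c d, K c d = ∑ b, ∑ a, J a b * D b d * D a c := by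
    intro c d
    rw [← h]
    simp only [Matrix.mul_apply, Matrix.transpose_apply, Finset.sum_mul]
    exact Finset.sum_congr rfl fun b _ => Finset.sum_congr rfl fun a _ => by ring
  simp only [hK, Finset.sum_smul, Finset.smul_sum, smul_smul]
  calc _ = ∑ a, ∑ b, ∑ c, ∑ d, (J a b * D b d * D a c) • f c d := by
        refine Finset.sum_congr rfl fun a _ => Finset.sum_congr rfl fun b _ => ?_
        rw [Finset.sum_comm]
        simp only [mul_assoc]
    _ = ∑ a, ∑ c, ∑ d, ∑ b, (J a b * D b d * D a c) • f c d := by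
        refine Finset.sum_congr rfl fun a _ => ?_
        rw [Finset.sum_comm]
        exact Finset.sum_congr rfl fun c _ => Finset.sum_comm
    _ = _ := by
        rw [Finset.sum_comm]
        refine Finset.sum_congr rfl fun c _ => ?_
        rw [Finset.sum_comm]
        exact Finset.sum_congr rfl fun d _ => Finset.sum_comm

theorem lapF_substF {D : Matrix (Fin (2 * n)) (Fin (2 * n)) ℝ} (hD : isSp n D) (w : Grass n) :
    lapF n (substF D w) = substF D (lapF n w) := by
  simp only [lapF_eq_Jmat, map_smul, map_sum, fpderiv_substF]
  rw [sum_bilin_transform _ _ _ hD fun c d => substF D (fpderiv n c (fpderiv n d w))]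

theorem isSp_transpose {D : Matrix (Fin (2 * n)) (Fin (2 * n)) ℝ} (hD : isSp n D) : isSp n Dᵀ := by
  rw [isSp] at hD ⊢
  rw [transpose_transpose]
  have hJ : Jmat n * ((-4 : ℝ) • Jmat n) = 1 := by
    rw [Matrix.mul_smul, Jmat_mul_self, smul_smul]; norm_num
  have h1 : ((-4 : ℝ) • (Jmat n * (Dᵀ * Jmat n))) * D = 1 := by
    rw [Matrix.smul_mul, Matrix.mul_assoc, hD, ← Matrix.mul_smul, hJ]
  have h2 := mul_eq_one_comm.1 h1
  calc D * Jmat n * Dᵀ = D * Jmat n * Dᵀ * (Jmat n * ((-4 : ℝ) • Jmat n)) := by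
        rw [hJ, Matrix.mul_one]
    _ = (D * ((-4 : ℝ) • (Jmat n * (Dᵀ * Jmat n)))) * Jmat n := by
        simp only [Matrix.mul_smul, Matrix.smul_mul, Matrix.mul_assoc]
    _ = Jmat n := by rw [h2, Matrix.one_mul]

theorem substF_rf2 {D : Matrix (Fin (2 * n)) (Fin (2 * n)) ℝ} (hD : isSp n D) :
    substF D (rf2 n) = rf2 n := by
  have h1 : ∀ a, substF D (fgen n a) = ∑ i, Dᵀ a i • fgen n i := by
    intro a
    rw [sum_smul_fgen, fgen, substF_ι]
    congr 1
    ext i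
    simp
  rw [rf2_eq_Jmat]
  simp only [map_sum, map_smul, map_mul, h1]
  rw [← sum_bilin_transform _ _ _ (isSp_transpose hD) fun c d => fgen n c * fgen n d]
  refine Finset.sum_congr rfl fun a _ => Finset.sum_congr rfl fun b _ => ?_
  congr 1
  rw [Finset.mul_sum]
  refine Finset.sum_congr rfl fun d _ => ?_
  rw [mul_smul_comm, Finset.sum_mul]
  simp only [smul_mul_assoc]

theorem substF_mem {D : Matrix (Fin (2 * n)) (Fin (2 * n)) ℝ} {q : ℕ} {w : Grass n}
    (hw : w ∈ fgrade n q) : substF D w ∈ fgrade n q := by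
  refine fgrade_induction (p := fun q w => substF D w ∈ fgrade n q) ?_ ?_ ?_ hw
  · intro r
    rw [AlgHom.commutes, fgrade, pow_zero]
    exact Submodule.algebraMap_mem r
  · intro q u w h1 h2
    rw [map_add]
    exact add_mem h1 h2
  · intro q v u _ h
    rw [map_mul, substF_ι]
    exact ι_mul_mem_fgrade _ h

theorem substF_mem_Hf {D : Matrix (Fin (2 * n)) (Fin (2 * n)) ℝ} (hD : isSp n D) {q : ℕ}
    {w : Grass n} (hw : w ∈ Hf n q) : substF D w ∈ Hf n q := by
  refine ⟨substF_mem hw.1, ?_⟩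
  show lapF n _ = 0
  rw [lapF_substF hD, show lapF n w = 0 from hw.2, map_zero]

theorem act_fkpq {A : Matrix (Fin m) (Fin m) ℝ} {D : Matrix (Fin (2 * n)) (Fin (2 * n)) ℝ}
    (hA : isSO m A) (hD : isSp n D) (l p q : ℕ) :
    act m n A D (fkpq m n l p q) = fkpq m n l p q := by
  simp only [fkpq, map_sum, map_smul, act_tmul, map_pow, substB_rb2 hA.1, substF_rf2 hD]

theorem act_mem_HbHf {A : Matrix (Fin m) (Fin m) ℝ} {D : Matrix (Fin (2 * n)) (Fin (2 * n)) ℝ}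
    (hA : isSO m A) (hD : isSp n D) {p q : ℕ} {u : SuperPoly m n} (hu : u ∈ HbHf m n p q) :
    act m n A D u ∈ HbHf m n p q := by
  have : HbHf m n p q ≤ (HbHf m n p q).comap (act m n A D).toLinearMap := by
    refine Submodule.map₂_le.2 fun h hh w hw => ?_
    exact Submodule.apply_mem_map₂ _ (substB_mem_Hb (mul_eq_one_comm.1 hA.1) hh)
      (substF_mem_Hf hD hw)
  exact this hu

theorem act_decompPiece_le (k : ℕ) (idx : decompIdx n k) {A : Matrix (Fin m) (Fin m) ℝ}
    {D : Matrix (Fin (2 * n)) (Fin (2 * n)) ℝ} (hA : isSO m A) (hD : isSp n D) :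
    (decompPiece m n k idx).map (act m n A D).toLinearMap ≤ decompPiece m n k idx := by
  rw [Submodule.map_le_iff_le_comap]
  rcases idx with i | ⟨j, l⟩
  · exact fun u hu => act_mem_HbHf hA hD hu
  · rintro _ ⟨u, hu, rfl⟩
    refine ⟨act m n A D u, act_mem_HbHf hA hD hu, ?_⟩
    change fkpq m n _ _ _ * act m n A D u = act m n A D (fkpq m n _ _ _ * u)
    rw [map_mul, act_fkpq hA hD]

/-- Stability under the action of `SO(m) × Sp(2n)`. -/
def ActStable (U : Submodule ℝ (SuperPoly m n)) : Prop :=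
  ∀ A D, isSO m A → isSp n D → U.map (act m n A D).toLinearMap ≤ U

theorem ActStable.act_mem {U : Submodule ℝ (SuperPoly m n)} (hU : ActStable U)
    {A : Matrix (Fin m) (Fin m) ℝ} {D : Matrix (Fin (2 * n)) (Fin (2 * n)) ℝ}
    (hA : isSO m A) (hD : isSp n D) {u : SuperPoly m n} (hu : u ∈ U) : act m n A D u ∈ U :=
  hU A D hA hD (Submodule.mem_map_of_mem hu)

theorem isSO_one : isSO m 1 := by simp [isSO]

theorem isSp_one : isSp n 1 := by simp [isSp]

/-- Multiplication by the generators of the super-polynomial algebra. -/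
def sx : Fin m ⊕ (Fin n ⊕ Fin n) → Module.End ℝ (SuperPoly m n)
  | .inl i => LinearMap.rTensor (Grass n) (LinearMap.mulLeft ℝ (X i))
  | .inr c => LinearMap.lTensor (MvPolynomial (Fin m) ℝ) (fx c)

/-- The derivatives of the super-polynomial algebra. -/
def sd : Fin m ⊕ (Fin n ⊕ Fin n) → Module.End ℝ (SuperPoly m n)
  | .inl i => LinearMap.rTensor (Grass n) (pderiv i).toLinearMap
  | .inr c => LinearMap.lTensor (MvPolynomial (Fin m) ℝ) (fd c)

section rotation

/-- The derivation of the polynomial algebra given by a matrix. -/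
def matrixDerivation (K : Matrix (Fin m) (Fin m) ℝ) :
    Derivation ℝ (MvPolynomial (Fin m) ℝ) (MvPolynomial (Fin m) ℝ) :=
  mkDerivation ℝ fun k => ∑ i, K k i • (X i : MvPolynomial (Fin m) ℝ)

theorem substB_one (p : MvPolynomial (Fin m) ℝ) : substB 1 p = p := by
  have : (substB 1 : MvPolynomial (Fin m) ℝ →ₐ[ℝ] _) = AlgHom.id ℝ _ := by
    ext j
    simp [substB_X, Matrix.one_apply, ite_smul]
  rw [this, AlgHom.id_apply]

theorem substF_one (w : Grass n) : substF 1 w = w := by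
  rw [substF, Matrix.toLin'_one, ExteriorAlgebra.map_id, AlgHom.id_apply]

theorem hasDerivAt_substB {A : ℝ → Matrix (Fin m) (Fin m) ℝ} {K : Matrix (Fin m) (Fin m) ℝ}
    (hA0 : A 0 = 1) (hA : ∀ k i, HasDerivAt (fun t => A t k i) (K k i) 0)
    (p : MvPolynomial (Fin m) ℝ) (μ : MvPolynomial (Fin m) ℝ →ₗ[ℝ] ℝ) :
    HasDerivAt (fun t => μ (substB (A t) p)) (μ (matrixDerivation K p)) 0 := by
  induction p using MvPolynomial.induction_on generalizing μ with
  | C r =>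
    have : ∀ t, substB (A t) (C r) = C r := fun t => by simp [substB]
    have h : matrixDerivation K (C r) = 0 := Derivation.map_algebraMap _ r
    simp only [this, h, map_zero]
    exact hasDerivAt_const _ _
  | add p q hp hq =>
    simp only [map_add]
    exact (hp μ).add (hq μ)
  | mul_X p k hp =>
    have h1 : ∀ t, μ (substB (A t) (p * X k)) =
        ∑ i, A t k i * (μ ∘ₗ LinearMap.mulRight ℝ (X i)) (substB (A t) p) := by
      intro t
      simp [substB_X, Finset.mul_sum, map_sum]
    have h2 : μ (matrixDerivation K (p * X k)) =
        ∑ i, (K k i * (μ ∘ₗ LinearMap.mulRight ℝ (X i)) (substB (A 0) p) +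
          A 0 k i * (μ ∘ₗ LinearMap.mulRight ℝ (X i)) (matrixDerivation K p)) := by
      rw [hA0, substB_one, Derivation.leibniz, matrixDerivation, mkDerivation_X]
      simp [Finset.sum_add_distrib, Finset.mul_sum, map_sum, Matrix.one_apply, mul_comm]
    simp only [h1, h2]
    exact HasDerivAt.fun_sum fun i _ => (hA k i).mul (hp _)

theorem ActStable.rTensor_matrixDerivation_mem {U : Submodule ℝ (SuperPoly m n)} (hU : ActStable U)
    {A : ℝ → Matrix (Fin m) (Fin m) ℝ} {K : Matrix (Fin m) (Fin m) ℝ}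
    (hA0 : A 0 = 1) (hA : ∀ k i, HasDerivAt (fun t => A t k i) (K k i) 0)
    (hSO : ∀ t, isSO m (A t)) {u : SuperPoly m n} (hu : u ∈ U) :
    LinearMap.rTensor (Grass n) (matrixDerivation K).toLinearMap u ∈ U := by
  have key : ∀ (φ : SuperPoly m n →ₗ[ℝ] ℝ) (u : SuperPoly m n),
      HasDerivAt (fun t => φ (act m n (A t) 1 u))
        (φ (LinearMap.rTensor (Grass n) (matrixDerivation K).toLinearMap u)) 0 := by
    intro φ u
    induction u using TensorProduct.induction_on with
    | zero => simpa using hasDerivAt_const (0 : ℝ) (0 : ℝ)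
    | tmul p w =>
      simp only [act_tmul, substF_one, LinearMap.rTensor_tmul]
      exact hasDerivAt_substB hA0 hA p (φ ∘ₗ (TensorProduct.mk ℝ _ _).flip w)
    | add u v hu hv =>
      simp only [map_add]
      exact hu.add hv
  by_contra hcon
  obtain ⟨φ, hφ, hle⟩ := Submodule.exists_le_ker_of_notMem hcon
  have h1 := key φ u
  have h2 : (fun t => φ (act m n (A t) 1 u)) = fun _ => 0 :=
    funext fun t => hle (hU.act_mem (hSO t) isSp_one hu)
  rw [h2] at h1
  exact hφ (h1.unique (hasDerivAt_const _ _))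

theorem isSO_exp {K : Matrix (Fin m) (Fin m) ℝ} (hK : Kᵀ = -K) : isSO m (NormedSpace.exp K) := by
  have h : ∀ L : Matrix (Fin m) (Fin m) ℝ, Lᵀ = -L →
      (NormedSpace.exp L)ᵀ * NormedSpace.exp L = 1 := by
    intro L hL
    rw [← Matrix.exp_transpose, hL, Matrix.exp_neg]
    exact Matrix.nonsing_inv_mul _ ((Matrix.isUnit_iff_isUnit_det _).1 (Matrix.isUnit_exp L))
  refine ⟨h K hK, ?_⟩
  have h2 : ((2⁻¹ : ℝ) • K)ᵀ = -((2⁻¹ : ℝ) • K) := by rw [Matrix.transpose_smul, hK, smul_neg]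
  have h3 := congrArg Matrix.det (h _ h2)
  rw [Matrix.det_mul, Matrix.det_transpose, Matrix.det_one] at h3
  have h4 : K = (2⁻¹ : ℝ) • K + (2⁻¹ : ℝ) • K := by rw [← add_smul]; norm_num
  rw [h4, Matrix.exp_add_of_commute _ _ (Commute.refl _), Matrix.det_mul, h3]

theorem hasDerivAt_exp_apply (K : Matrix (Fin m) (Fin m) ℝ) (k i : Fin m) :
    HasDerivAt (fun t : ℝ => NormedSpace.exp (t • K) k i) (K k i) 0 := by
  let _ : NormedRing (Matrix (Fin m) (Fin m) ℝ) := Matrix.linftyOpNormedRing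
  let _ : NormedAlgebra ℝ (Matrix (Fin m) (Fin m) ℝ) := Matrix.linftyOpNormedAlgebra
  have h := hasDerivAt_exp_smul_const K (0 : ℝ)
  have h2 := (LinearMap.toContinuousLinearMap
    (Matrix.entryLinearMap ℝ ℝ k i)).hasFDerivAt.comp_hasDerivAt (0 : ℝ) h
  refine h2.congr_deriv ?_
  rw [zero_smul, NormedSpace.exp_zero, one_mul]
  rfl

theorem ActStable.rotation_mem {U : Submodule ℝ (SuperPoly m n)} (hU : ActStable U) (i j : Fin m)
    {u : SuperPoly m n} (hu : u ∈ U) :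
    sx (.inl i) (sd (.inl j) u) - sx (.inl j) (sd (.inl i) u) ∈ U := by
  set K : Matrix (Fin m) (Fin m) ℝ := Matrix.single j i 1 - Matrix.single i j 1 with hK
  have hKt : ∀ t : ℝ, (t • K)ᵀ = -(t • K) := by
    intro t
    rw [hK, Matrix.transpose_smul, Matrix.transpose_sub, Matrix.transpose_single,
      Matrix.transpose_single, ← smul_neg, neg_sub]
  have h := hU.rTensor_matrixDerivation_mem (A := fun t => NormedSpace.exp (t • K)) (by simp)
    (hasDerivAt_exp_apply K) (fun t => isSO_exp (hKt t)) hu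
  have hD : matrixDerivation K = (X i : MvPolynomial (Fin m) ℝ) • pderiv j -
      (X j : MvPolynomial (Fin m) ℝ) • pderiv i := by
    refine MvPolynomial.derivation_ext fun k => ?_
    rw [matrixDerivation, mkDerivation_X]
    simp [hK, Matrix.single_apply, sub_smul, Finset.sum_sub_distrib, pderiv_X, Pi.single_apply,
      ite_and, eq_comm]
  have hE : LinearMap.rTensor (Grass n) (matrixDerivation K).toLinearMap =
      sx (.inl i) * sd (.inl j) - sx (.inl j) * sd (.inl i) := by
    rw [hD]
    refine TensorProduct.ext' fun p w => ?_
    simp [sx, sd]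
  rwa [hE] at h

end rotation

section transvection

/-- The operator `x_v ∂_φ` on the Grassmann algebra, where `φ` is the functional dual to `w` with
respect to the symplectic form. -/
def spOp (v w : Fin (2 * n) → ℝ) : Module.End ℝ (Grass n) :=
  LinearMap.mulLeft ℝ (ExteriorAlgebra.ι ℝ v) * ∑ b, (w ᵥ* Jmat n) b • fpderiv n b

theorem Jmat_transpose : (Jmat n)ᵀ = - Jmat n := by
  ext a b
  obtain ⟨c, rfl⟩ := (fidx_bijective n).2 a
  obtain ⟨c', rfl⟩ := (fidx_bijective n).2 b
  simp only [Matrix.transpose_apply, Matrix.neg_apply, Jmat_fidx]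
  rcases c with i | i <;> rcases c' with j | j <;> simp [eq_comm] <;> split_ifs <;> norm_num

theorem vecMul_Jmat_dotProduct_self (v : Fin (2 * n) → ℝ) : (v ᵥ* Jmat n) ⬝ᵥ v = 0 := by
  have h : (v ᵥ* Jmat n) ⬝ᵥ v = -((v ᵥ* Jmat n) ⬝ᵥ v) := by
    conv_lhs => rw [dotProduct_comm, ← Matrix.mulVec_transpose, Jmat_transpose, Matrix.neg_mulVec,
      dotProduct_neg, Matrix.dotProduct_mulVec]
  linarith

theorem isSp_transvection (v : Fin (2 * n) → ℝ) :
    isSp n (1 + Matrix.vecMulVec v (v ᵥ* Jmat n)) := by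
  have h1 : Jmat n *ᵥ v = -(v ᵥ* Jmat n) := by
    rw [← Matrix.mulVec_transpose, Jmat_transpose, Matrix.neg_mulVec, neg_neg]
  rw [isSp, Matrix.transpose_add, Matrix.transpose_vecMulVec, Matrix.transpose_one, Matrix.add_mul,
    Matrix.one_mul, Matrix.vecMulVec_mul, Matrix.mul_add, Matrix.add_mul, Matrix.mul_one,
    Matrix.mul_one, Matrix.mul_vecMulVec, Matrix.add_mulVec, h1, Matrix.vecMulVec_mulVec,
    vecMul_Jmat_dotProduct_self]
  simp

theorem substF_transvection (v f : Fin (2 * n) → ℝ) (w : Grass n) :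
    substF (1 + Matrix.vecMulVec v f) w =
      w + ExteriorAlgebra.ι ℝ v * ∑ b, f b • fpderiv n b w := by
  have hc : ∀ y x, ∑ b, f b • fpderiv n b (ExteriorAlgebra.ι ℝ y * x) =
      (f ⬝ᵥ y) • x - ExteriorAlgebra.ι ℝ y * ∑ b, f b • fpderiv n b x := by
    intro y x
    simp only [fpderiv_ι_mul, smul_sub, Finset.sum_sub_distrib, Finset.mul_sum, mul_smul_comm,
      smul_smul, ← Finset.sum_smul, dotProduct]
  have hvv : ∀ x : Grass n, ExteriorAlgebra.ι ℝ v * (ExteriorAlgebra.ι ℝ v * x) = 0 := by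
    intro x
    rw [← mul_assoc, ExteriorAlgebra.ι_sq_zero, zero_mul]
  induction w using CliffordAlgebra.left_induction with
  | algebraMap r =>
    simp only [Algebra.algebraMap_eq_smul_one, map_smul, map_one, fpderiv_one, smul_zero,
      Finset.sum_const_zero, mul_zero, add_zero]
  | add x y hx hy => simp only [map_add, hx, hy, smul_add, Finset.sum_add_distrib, mul_add]; abel
  | ι_mul v' x hx =>
    change substF _ (ExteriorAlgebra.ι ℝ x * v') = ExteriorAlgebra.ι ℝ x * v' +
      ExteriorAlgebra.ι ℝ v * ∑ b, f b • fpderiv n b (ExteriorAlgebra.ι ℝ x * v')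
    have h1 : (1 + Matrix.vecMulVec v f) *ᵥ x = x + (f ⬝ᵥ x) • v := by
      rw [Matrix.add_mulVec, Matrix.one_mulVec, Matrix.vecMulVec_mulVec]
      simp
    have h2 : ExteriorAlgebra.ι ℝ x * (ExteriorAlgebra.ι ℝ v * ∑ b, f b • fpderiv n b v') =
        -(ExteriorAlgebra.ι ℝ v * (ExteriorAlgebra.ι ℝ x * ∑ b, f b • fpderiv n b v')) := by
      rw [← mul_assoc, ι_mul_swap, neg_mul, mul_assoc]
    rw [map_mul, hx, substF_ι, h1, hc, map_add, map_smul, add_mul, mul_add, mul_add, h2, mul_sub,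
      smul_mul_assoc, smul_mul_assoc, hvv, mul_smul_comm]
    simp only [smul_zero]
    abel

theorem ActStable.lTensor_spOp_self_mem {U : Submodule ℝ (SuperPoly m n)} (hU : ActStable U)
    (v : Fin (2 * n) → ℝ) {u : SuperPoly m n} (hu : u ∈ U) :
    LinearMap.lTensor (MvPolynomial (Fin m) ℝ) (spOp v v) u ∈ U := by
  have h : (act m n 1 (1 + Matrix.vecMulVec v (v ᵥ* Jmat n))).toLinearMap =
      LinearMap.id + LinearMap.lTensor (MvPolynomial (Fin m) ℝ) (spOp v v) := by
    refine TensorProduct.ext' fun p w => ?_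
    simp only [AlgHom.toLinearMap_apply, act_tmul, substB_one,
      substF_transvection, TensorProduct.tmul_add]
    simp [spOp, LinearMap.sum_apply, Finset.mul_sum]
  have h1 := hU.act_mem isSO_one (isSp_transvection v) hu
  rw [← AlgHom.toLinearMap_apply, h, LinearMap.add_apply, LinearMap.id_apply] at h1
  simpa using sub_mem h1 hu

theorem ActStable.lTensor_spOp_mem {U : Submodule ℝ (SuperPoly m n)} (hU : ActStable U)
    (v w : Fin (2 * n) → ℝ) {u : SuperPoly m n} (hu : u ∈ U) :
    LinearMap.lTensor (MvPolynomial (Fin m) ℝ) (spOp v w + spOp w v) u ∈ U := by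
  have h : spOp v w + spOp w v = spOp (v + w) (v + w) - spOp v v - spOp w w := by
    refine LinearMap.ext fun x => ?_
    simp only [spOp, LinearMap.add_apply, LinearMap.sub_apply, Module.End.mul_apply, map_add,
      Matrix.add_vecMul, Pi.add_apply, add_smul, LinearMap.sum_apply, Finset.sum_add_distrib,
      LinearMap.mulLeft_apply, add_mul]
    abel
  rw [h, LinearMap.lTensor_sub, LinearMap.lTensor_sub, LinearMap.sub_apply, LinearMap.sub_apply]
  exact sub_mem (sub_mem (hU.lTensor_spOp_self_mem _ hu) (hU.lTensor_spOp_self_mem _ hu))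
    (hU.lTensor_spOp_self_mem _ hu)

theorem spOp_single (c c' : Fin n ⊕ Fin n) :
    spOp (Pi.single (fidx n c) 1) (Pi.single (fidx n c') 1) =
      match c' with
      | .inl i => (1 / 2 : ℝ) • (fx c * fd (.inr i))
      | .inr i => (-1 / 2 : ℝ) • (fx c * fd (.inl i)) := by
  have h := sum_Jmat_row (M := Module.End ℝ (Grass n)) c' (fpderiv n)
  rw [spOp, Matrix.single_one_vecMul]
  refine (congrArg _ h).trans ?_
  rcases c' with i | i <;> simp only [mul_smul_comm] <;> rfl

theorem ActStable.spStable {U : Submodule ℝ (SuperPoly m n)} (hU : ActStable U) :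
    SpStable (fun c => sx (m := m) (n := n) (.inr c)) (fun c => sd (.inr c)) U := by
  have hm : ∀ c c' : Fin n ⊕ Fin n, ∀ w : SuperPoly m n, sx (.inr c) (sd (.inr c') w) =
      LinearMap.lTensor (MvPolynomial (Fin m) ℝ) (fx c * fd c') w := by
    intro c c' w
    rw [LinearMap.lTensor_mul]; rfl
  have h := fun (c c' : Fin n ⊕ Fin n) (w : SuperPoly m n) (hw : w ∈ U) =>
    hU.lTensor_spOp_mem (Pi.single (fidx n c) 1) (Pi.single (fidx n c') 1) hw
  simp only [spOp_single, LinearMap.lTensor_add, LinearMap.add_apply] at h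
  have h2 : ∀ w, (2 : ℝ) • w ∈ U → w ∈ U := fun w hw => by
    simpa using Submodule.smul_mem _ (2⁻¹ : ℝ) hw
  refine ⟨fun j u hu => ?_, fun j u hu => ?_, fun i j _ u hu => ?_, fun i j _ u hu => ?_,
    fun i j _ u hu => ?_⟩
  · have := h (.inl j) (.inl j) u hu
    simp only [LinearMap.lTensor_smul, LinearMap.smul_apply, ← hm] at this
    convert this using 1
    module
  · have := neg_mem (h (.inr j) (.inr j) u hu)
    simp only [LinearMap.lTensor_smul, LinearMap.smul_apply, ← hm] at this
    convert this using 1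
    module
  · have := h (.inl j) (.inl i) u hu
    simp only [LinearMap.lTensor_smul, LinearMap.smul_apply, ← hm] at this
    convert Submodule.smul_mem _ (2 : ℝ) this using 1
    module
  · have := h (.inr j) (.inr i) u hu
    simp only [LinearMap.lTensor_smul, LinearMap.smul_apply, ← hm] at this
    convert Submodule.smul_mem _ (-2 : ℝ) this using 1
    module
  · have := h (.inr i) (.inl j) u hu
    simp only [LinearMap.lTensor_smul, LinearMap.smul_apply, ← hm] at this
    convert Submodule.smul_mem _ (2 : ℝ) this using 1
    module

end transvection

/-- The commutation signs of the generators of the super-polynomial algebra. -/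
def superSign : Fin m ⊕ (Fin n ⊕ Fin n) → Fin m ⊕ (Fin n ⊕ Fin n) → ℝ
  | .inr _, .inr _ => -1
  | _, _ => 1

theorem pderiv_X_mul (i j : Fin m) (p : MvPolynomial (Fin m) ℝ) :
    pderiv i (X j * p) = (if i = j then p else 0) + X j * pderiv i p := by
  rw [Derivation.leibniz, pderiv_X, Pi.single_apply, add_comm]
  by_cases h : i = j
  · simp [h]
  · simp [h, Ne.symm h]

theorem pderiv_comm (i j : Fin m) (p : MvPolynomial (Fin m) ℝ) :
    pderiv i (pderiv j p) = pderiv j (pderiv i p) := by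
  have h : ⁅pderiv (R := ℝ) i, pderiv (R := ℝ) j⁆ = 0 := by
    refine MvPolynomial.derivation_ext fun k => ?_
    simp [Derivation.commutator_apply, pderiv_X, Pi.single_apply, apply_ite]
  have := congrArg (fun D => D p) h
  simpa [Derivation.commutator_apply, sub_eq_zero] using this

theorem isSuperWeyl : IsSuperWeyl (superSign (m := m) (n := n)) sx sd where
  dx i j u := by
    induction u using TensorProduct.induction_on with
    | zero => simp
    | add u v hu hv =>
      simp only [map_add, hu, hv, smul_add]
      split_ifs <;> abel
    | tmul p w =>
      rcases i with i | i <;> rcases j with j | j <;>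
        simp only [sx, sd, superSign, LinearMap.rTensor_tmul, LinearMap.lTensor_tmul,
          LinearMap.mulLeft_apply, Derivation.coeFn_coe, pderiv_X_mul, isCAR_fermion.dx, one_smul,
          TensorProduct.add_tmul, TensorProduct.tmul_sub, Sum.inl.injEq, Sum.inr.injEq,
          reduceCtorEq, if_false, zero_add]
      · split_ifs <;> simp
      · split_ifs <;> simp [sub_eq_add_neg]
  dd i j u := by
    induction u using TensorProduct.induction_on with
    | zero => simp
    | add u v hu hv => simp only [map_add, hu, hv, smul_add]
    | tmul p w =>
      rcases i with i | i <;> rcases j with j | j <;>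
        simp only [sd, superSign, LinearMap.rTensor_tmul, LinearMap.lTensor_tmul,
          Derivation.coeFn_coe, one_smul]
      · rw [pderiv_comm]
      · rw [isCAR_fermion.dd]; simp [TensorProduct.tmul_neg]

theorem isCAR_super : IsCAR (fun c => sx (m := m) (n := n) (.inr c)) (fun c => sd (.inr c)) where
  dx i j u := by
    rw [isSuperWeyl.dx]
    simp [superSign, sub_eq_add_neg]
  dd i j u := by
    rw [isSuperWeyl.dd]
    simp [superSign]
  xx i j u := by
    induction u using TensorProduct.induction_on with
    | zero => simp
    | add u v hu hv => simp only [map_add, hu, hv, neg_add]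
    | tmul p w =>
      simp only [sx, LinearMap.lTensor_tmul]
      rw [isCAR_fermion.xx, TensorProduct.tmul_neg]

theorem P_le_of_tmul {k : ℕ} {W : Submodule ℝ (SuperPoly m n)}
    (h : ∀ a b, a + b = k → ∀ p : MvPolynomial (Fin m) ℝ, p.IsHomogeneous a →
      ∀ w ∈ fgrade n b, p ⊗ₜ w ∈ W) : P m n k ≤ W :=
  iSup_le fun i => Submodule.map₂_le.2 fun p hp w hw =>
    h (k - i.1) i.1 (by omega) p hp w hw

theorem sd_mem_P (k : ℕ) (u : SuperPoly m n) (hu : u ∈ P m n (k + 1))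
    (i : Fin m ⊕ (Fin n ⊕ Fin n)) : sd i u ∈ P m n k := by
  refine (P_le_of_tmul (W := (P m n k).comap (sd i)) fun a b hab p hp w hw => ?_) hu
  rw [Submodule.mem_comap]
  rcases i with i | c
  · change pderiv i p ⊗ₜ w ∈ _
    rcases a with _ | a
    · rw [pderiv_isHomogeneous_zero i hp, TensorProduct.zero_tmul]; exact zero_mem _
    · exact tmul_mem_P (a := a) (b := b) (by omega) (hp.pderiv (i := i)) hw
  · change p ⊗ₜ fd c w ∈ _
    rcases b with _ | b
    · rw [show fd c w = 0 from fpderiv_fgrade_zero _ hw, TensorProduct.tmul_zero]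
      exact zero_mem _
    · exact tmul_mem_P (a := a) (b := b) (by omega) hp (fd_mem c hw)

theorem sd_P_zero (u : SuperPoly m n) (hu : u ∈ P m n 0) (i : Fin m ⊕ (Fin n ⊕ Fin n)) :
    sd i u = 0 := by
  refine (P_le_of_tmul (W := LinearMap.ker (sd i)) fun a b hab p hp w hw => ?_) hu
  obtain ⟨rfl, rfl⟩ : a = 0 ∧ b = 0 := by omega
  rw [LinearMap.mem_ker]
  rcases i with i | c
  · change pderiv i p ⊗ₜ w = _
    rw [pderiv_isHomogeneous_zero i hp, TensorProduct.zero_tmul]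
  · change p ⊗ₜ fd c w = _
    rw [show fd c w = 0 from fpderiv_fgrade_zero _ hw, TensorProduct.tmul_zero]

theorem number_super (k : ℕ) (u : SuperPoly m n) (hu : u ∈ P m n k) :
    ∑ i, sx i (sd i u) = (k : ℝ) • u := by
  have h := (P_le_of_tmul (W := LinearMap.ker ((∑ i, sx i * sd i) - (k : ℝ) • 1))
    fun a b hab p hp w hw => ?_) hu
  · simpa [LinearMap.sum_apply, sub_eq_zero] using h
  · have h1 : ∑ i, sx (m := m) (n := n) (.inl i) (sd (.inl i) (p ⊗ₜ w)) = (a : ℝ) • (p ⊗ₜ w) := by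
      have := hp.sum_X_mul_pderiv
      rw [← Nat.cast_smul_eq_nsmul ℝ] at this
      rw [TensorProduct.smul_tmul', ← this, TensorProduct.sum_tmul]
      rfl
    have h2 : ∑ c, sx (m := m) (n := n) (.inr c) (sd (.inr c) (p ⊗ₜ w)) = (b : ℝ) • (p ⊗ₜ w) := by
      rw [← TensorProduct.tmul_smul, ← number_fermion b w hw, TensorProduct.tmul_sum]
      rfl
    simp only [LinearMap.mem_ker, LinearMap.sub_apply, LinearMap.sum_apply, Module.End.mul_apply,
      LinearMap.smul_apply, Module.End.one_apply]
    rw [Fintype.sum_sum_type, h1, h2, ← hab]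
    push_cast
    module

theorem sd_P_injective (k : ℕ) (u : SuperPoly m n) (hu : u ∈ P m n (k + 1))
    (h : ∀ i, sd i u = 0) : u = 0 := by
  have := number_super (k + 1) u hu
  simp only [h, map_zero, Finset.sum_const_zero] at this
  exact (smul_eq_zero.1 this.symm).resolve_left (by positivity)

/-- Stability under the operators spanning the Lie algebras of `SO(m)` and `Sp(2n)`. -/
structure LieStable (U : Submodule ℝ (SuperPoly m n)) : Prop where
  rotation : ∀ i j, ∀ u ∈ U, sx (.inl i) (sd (.inl j) u) - sx (.inl j) (sd (.inl i) u) ∈ U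
  sp : SpStable (fun c => sx (m := m) (n := n) (.inr c)) (fun c => sd (.inr c)) U

theorem ActStable.lieStable {U : Submodule ℝ (SuperPoly m n)} (hU : ActStable U) : LieStable U :=
  ⟨fun i j _ hu => hU.rotation_mem i j hu, hU.spStable⟩

/-- The orthogonal complement of `U` in `V` for the Fischer form of degree `k`. -/
def fischerCompl (k : ℕ) (U V : Submodule ℝ (SuperPoly m n)) : Submodule ℝ (SuperPoly m n) where
  carrier := {w | w ∈ V ∧ ∀ u ∈ U, fischerForm sd k u w = 0}
  add_mem' h1 h2 := ⟨add_mem h1.1 h2.1, fun u hu => by rw [map_add, h1.2 u hu, h2.2 u hu, add_zero]⟩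
  zero_mem' := ⟨zero_mem _, fun u _ => map_zero _⟩
  smul_mem' c _ h := ⟨Submodule.smul_mem _ c h.1, fun u hu => by rw [map_smul, h.2 u hu, smul_zero]⟩

theorem fischerCompl_lieStable {k : ℕ} {U V : Submodule ℝ (SuperPoly m n)} (hU : LieStable U)
    (hV : LieStable V) (hUV : U ≤ V) (hVP : V ≤ P m n k) : LieStable (fischerCompl k U V) := by
  have hadj := fischerForm_adjoint isSuperWeyl (sd_P_zero (m := m) (n := n)) sd_mem_P k
  have had : ∀ i j, ∀ u ∈ U, ∀ w ∈ V, fischerForm sd k u (sx i (sd j w)) =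
      fischerForm sd k (sx j (sd i u)) w := fun i j u hu w hw =>
    (hadj j i u w (hVP (hUV hu)) (hVP hw)).symm
  refine ⟨fun i j w hw => ⟨hV.rotation i j w hw.1, fun u hu => ?_⟩,
    ⟨fun j w hw => ⟨hV.sp.raise j w hw.1, fun u hu => ?_⟩,
    fun j w hw => ⟨hV.sp.lower j w hw.1, fun u hu => ?_⟩,
    fun i j hij w hw => ⟨hV.sp.raise₂ i j hij w hw.1, fun u hu => ?_⟩,
    fun i j hij w hw => ⟨hV.sp.lower₂ i j hij w hw.1, fun u hu => ?_⟩,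
    fun i j hij w hw => ⟨hV.sp.mixed i j hij w hw.1, fun u hu => ?_⟩⟩⟩
  · rw [map_sub, had _ _ u hu w hw.1, had _ _ u hu w hw.1, ← LinearMap.sub_apply, ← map_sub]
    exact hw.2 _ (hU.rotation j i u hu)
  · rw [had _ _ u hu w hw.1]
    exact hw.2 _ (hU.sp.lower j u hu)
  · rw [had _ _ u hu w hw.1]
    exact hw.2 _ (hU.sp.raise j u hu)
  · rw [map_add, had _ _ u hu w hw.1, had _ _ u hu w hw.1, ← LinearMap.add_apply, ← map_add]
    exact hw.2 _ (hU.sp.lower₂ j i hij.symm u hu)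
  · rw [map_add, had _ _ u hu w hw.1, had _ _ u hu w hw.1, ← LinearMap.add_apply, ← map_add]
    exact hw.2 _ (hU.sp.raise₂ j i hij.symm u hu)
  · rw [map_sub, had _ _ u hu w hw.1, had _ _ u hu w hw.1, ← LinearMap.sub_apply, ← map_sub]
    exact hw.2 _ (hU.sp.mixed j i hij.symm u hu)

theorem fischer_definite {k : ℕ} {u : SuperPoly m n} (hu : u ∈ P m n k)
    (h : fischerForm sd k u u = 0) : u = 0 :=
  fischerForm_definite sd_mem_P sd_P_injective k u hu h

theorem fischerCompl_ne_bot {k : ℕ} {U V : Submodule ℝ (SuperPoly m n)} [FiniteDimensional ℝ V]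
    (hUV : U ≤ V) (hne : U ≠ V) (hVP : V ≤ P m n k) : fischerCompl k U V ≠ ⊥ := by
  have : FiniteDimensional ℝ U := Submodule.finiteDimensional_of_le hUV
  obtain ⟨v, hv, hvU⟩ := SetLike.exists_of_lt (lt_of_le_of_ne hUV hne)
  obtain ⟨z, hz, hzφ⟩ := exists_bilin_representative (fischerForm sd k) U
    (fun u hu h => fischer_definite (hVP (hUV hu)) h) (fischerForm sd k v)
  refine (Submodule.ne_bot_iff _).2 ⟨v - z, ⟨sub_mem hv (hUV hz), fun u hu => ?_⟩, fun h => ?_⟩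
  · rw [map_sub, fischerForm_symm, fischerForm_symm sd k u z, hzφ u hu, sub_self]
  · rw [sub_eq_zero.1 h] at hvU
    exact hvU hz

instance HbHf_finite (p q : ℕ) : FiniteDimensional ℝ (HbHf m n p q) := by
  refine Module.Finite.iff_fg.2 ?_
  have h1 : FiniteDimensional ℝ (Hb m p) := Submodule.finiteDimensional_of_le
    (S₂ := homogeneousSubmodule (Fin m) ℝ p) inf_le_left
  have h2 : FiniteDimensional ℝ (Hf n q) := Submodule.finiteDimensional_of_le
    (S₂ := fgrade n q) inf_le_left
  exact Submodule.FG.map₂ _ (Module.Finite.iff_fg.1 h1) (Module.Finite.iff_fg.1 h2)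

theorem HbHf_actStable (p q : ℕ) : ActStable (HbHf m n p q) := by
  rintro A D hA hD _ ⟨u, hu, rfl⟩
  exact act_mem_HbHf hA hD hu

/-- The elements of `ℋ^b_p ⊗ Λ^q` divisible by a given product of `q` fermionic generators are
multiples of that product. -/
theorem exists_eq_tmul_of_sx_eq_zero (p : ℕ) (S : Finset (Fin n)) : ∃ w : Grass n,
    ∀ u ∈ Submodule.map₂ (TensorProduct.mk ℝ _ _) (Hb m p) (fgrade n S.card),
      (∀ i ∈ S, sx (m := m) (n := n) (.inr (.inl i)) u = 0) → ∃ v, u = v ⊗ₜ w := by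
  induction S using Finset.induction_on with
  | empty =>
    refine ⟨1, fun u hu _ => ?_⟩
    have h : Submodule.map₂ (TensorProduct.mk ℝ _ _) (Hb m p) (fgrade n 0) ≤
        LinearMap.range ((TensorProduct.mk ℝ (MvPolynomial (Fin m) ℝ) (Grass n)).flip 1) := by
      refine Submodule.map₂_le.2 fun v _ w hw => ?_
      rw [fgrade, pow_zero, Submodule.mem_one] at hw
      obtain ⟨r, rfl⟩ := hw
      refine ⟨r • v, ?_⟩
      rw [Algebra.algebraMap_eq_smul_one]
      simp
    obtain ⟨v, hv⟩ := h hu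
    exact ⟨v, hv.symm⟩
  | insert j S hj ih =>
    obtain ⟨w, hw⟩ := ih
    refine ⟨fx (.inl j) w, fun u hu hS => ?_⟩
    rw [Finset.card_insert_of_notMem hj] at hu
    have h1 : sd (m := m) (n := n) (.inr (.inl j)) u ∈
        Submodule.map₂ (TensorProduct.mk ℝ _ _) (Hb m p) (fgrade n S.card) := by
      have hle : Submodule.map₂ (TensorProduct.mk ℝ _ _) (Hb m p) (fgrade n (S.card + 1)) ≤
          (Submodule.map₂ (TensorProduct.mk ℝ _ _) (Hb m p) (fgrade n S.card)).comap
            (sd (m := m) (n := n) (.inr (.inl j))) :=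
        Submodule.map₂_le.2 fun v hv w hw => Submodule.apply_mem_map₂ _ hv (fd_mem _ hw)
      exact hle hu
    obtain ⟨v, hv⟩ := hw _ h1 fun i hi => by
      have hij : (Sum.inl j : Fin n ⊕ Fin n) ≠ .inl i := fun e => hj (Sum.inl_injective e ▸ hi)
      have := isCAR_super.dx_ne hij u
      rw [hS i (Finset.mem_insert_of_mem hi), map_zero] at this
      exact neg_eq_zero.1 this.symm
    refine ⟨v, ?_⟩
    have := isCAR_super.dx_self (.inl j) u
    rw [hS j (Finset.mem_insert_self j S), map_zero, hv] at this
    exact sub_eq_zero.1 this.symm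

theorem eq_zero_of_pderiv_eq_zero {d : ℕ} {p : MvPolynomial (Fin m) ℝ}
    (hp : p.IsHomogeneous (d + 1))
    (h : ∀ i, pderiv i p = 0) : p = 0 := by
  have := hp.sum_X_mul_pderiv
  simp only [h, mul_zero, Finset.sum_const_zero] at this
  exact (smul_eq_zero.1 this.symm).resolve_left (by positivity)

/-- The coefficient of the `k`-th power of the zeroth variable. -/
def coeffZero (k : ℕ) : MvPolynomial (Fin (m + 1)) ℝ →ₗ[ℝ] MvPolynomial (Fin m) ℝ :=
  (Polynomial.lcoeff (MvPolynomial (Fin m) ℝ) k).restrictScalars ℝ ∘ₗ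
    (finSuccEquiv ℝ m).toLinearMap

theorem coeffZero_apply (k : ℕ) (u : MvPolynomial (Fin (m + 1)) ℝ) :
    coeffZero k u = (finSuccEquiv ℝ m u).coeff k := rfl

theorem coeffZero_zero_X_zero_mul (u : MvPolynomial (Fin (m + 1)) ℝ) :
    coeffZero 0 (X 0 * u) = 0 := by
  rw [coeffZero_apply, map_mul, finSuccEquiv_X_zero, Polynomial.coeff_X_mul_zero]

theorem coeffZero_succ_X_zero_mul (k : ℕ) (u : MvPolynomial (Fin (m + 1)) ℝ) :
    coeffZero (k + 1) (X 0 * u) = coeffZero k u := by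
  rw [coeffZero_apply, map_mul, finSuccEquiv_X_zero, Polynomial.coeff_X_mul, coeffZero_apply]

theorem coeffZero_X_succ_mul (k : ℕ) (a : Fin m) (u : MvPolynomial (Fin (m + 1)) ℝ) :
    coeffZero k (X a.succ * u) = X a * coeffZero k u := by
  rw [coeffZero_apply, map_mul, finSuccEquiv_X_succ, Polynomial.coeff_C_mul, coeffZero_apply]

theorem coeffZero_pderiv_zero (k : ℕ) (u : MvPolynomial (Fin (m + 1)) ℝ) :
    coeffZero k (pderiv 0 u) = ((k : ℝ) + 1) • coeffZero (k + 1) u := by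
  induction u using MvPolynomial.induction_on generalizing k with
  | C a => simp [coeffZero_apply, finSuccEquiv_apply]
  | add p q hp hq => simp only [map_add, hp, hq, smul_add]
  | mul_X p i hp =>
    rw [mul_comm, pderiv_X_mul, map_add]
    cases i using Fin.cases with
    | zero =>
      rw [if_pos rfl, coeffZero_succ_X_zero_mul]
      rcases k with _ | k
      · simp [coeffZero_zero_X_zero_mul]
      · rw [coeffZero_succ_X_zero_mul, hp]
        push_cast
        module
    | succ a =>
      rw [if_neg (Fin.succ_ne_zero a).symm, map_zero, zero_add, coeffZero_X_succ_mul, hp,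
        coeffZero_X_succ_mul, mul_smul_comm]

theorem coeffZero_pderiv_succ (k : ℕ) (b : Fin m) (u : MvPolynomial (Fin (m + 1)) ℝ) :
    coeffZero k (pderiv b.succ u) = pderiv b (coeffZero k u) := by
  induction u using MvPolynomial.induction_on generalizing k with
  | C a =>
    simp only [pderiv_C, map_zero, coeffZero_apply, finSuccEquiv_apply, eval₂Hom_C,
      RingHom.comp_apply, Polynomial.coeff_C]
    split_ifs <;> simp
  | add p q hp hq => simp only [map_add, hp, hq]
  | mul_X p i hp =>
    rw [mul_comm, pderiv_X_mul, map_add]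
    cases i using Fin.cases with
    | zero =>
      rw [if_neg (Fin.succ_ne_zero b), map_zero, zero_add]
      rcases k with _ | k
      · simp [coeffZero_zero_X_zero_mul]
      · rw [coeffZero_succ_X_zero_mul, coeffZero_succ_X_zero_mul, hp]
    | succ a =>
      simp only [Fin.succ_inj]
      rw [coeffZero_X_succ_mul, coeffZero_X_succ_mul, hp, pderiv_X_mul]
      split_ifs <;> simp

theorem coeffZero_isHomogeneous {p : ℕ} {u : MvPolynomial (Fin (m + 1)) ℝ} (hu : u.IsHomogeneous p)
    {k j : ℕ} (h : k + j = p) : (coeffZero k u).IsHomogeneous j :=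
  hu.finSuccEquiv_coeff_isHomogeneous k j h

theorem coeffZero_eq_zero {p : ℕ} {u : MvPolynomial (Fin (m + 1)) ℝ} (hu : u.IsHomogeneous p)
    {k : ℕ} (h : p < k) : coeffZero k u = 0 := by
  rw [coeffZero_apply]
  refine Polynomial.coeff_eq_zero_of_natDegree_lt ?_
  rw [natDegree_finSuccEquiv]
  exact ((degreeOf_le_totalDegree u 0).trans hu.totalDegree_le).trans_lt h

theorem eq_zero_of_coeffZero {u : MvPolynomial (Fin (m + 1)) ℝ} (h : ∀ k, coeffZero k u = 0) :
    u = 0 := by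
  rw [← map_eq_zero_iff (finSuccEquiv ℝ m) (finSuccEquiv ℝ m).injective]
  exact Polynomial.ext h

theorem eq_zero_of_isHomogeneous_zero {u : MvPolynomial (Fin m) ℝ} (hu : u.IsHomogeneous 0)
    (h : constantCoeff u = 0) : u = 0 := by
  rw [← mem_homogeneousSubmodule, homogeneousSubmodule_zero, Submodule.mem_one] at hu
  obtain ⟨r, rfl⟩ := hu
  rw [MvPolynomial.algebraMap_eq, constantCoeff_C] at h
  rw [h, map_zero]

/-- The infinitesimal rotations. -/
def rot (i j : Fin m) : Module.End ℝ (MvPolynomial (Fin m) ℝ) :=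
  LinearMap.mulLeft ℝ (X i) ∘ₗ (pderiv j).toLinearMap -
    LinearMap.mulLeft ℝ (X j) ∘ₗ (pderiv i).toLinearMap

theorem rot_apply (i j : Fin m) (u : MvPolynomial (Fin m) ℝ) :
    rot i j u = X i * pderiv j u - X j * pderiv i u := rfl

/-- Homogeneous polynomials of degree `p` invariant under the rotations fixing the zeroth axis are
determined, if harmonic, by their two leading coefficients in the zeroth variable. -/
theorem eq_zero_of_zonal {p : ℕ} {u : MvPolynomial (Fin (m + 1)) ℝ} (hu : u ∈ Hb (m + 1) p)
    (hrot : ∀ a b : Fin m, rot a.succ b.succ u = 0)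
    (h0 : ∀ k, p ≤ k + 1 → coeffZero k u = 0) : u = 0 := by
  have hhom : u.IsHomogeneous p := hu.1
  have key : ∀ j, ∀ k, p ≤ k + j → coeffZero k u = 0 := by
    intro j
    induction j using Nat.strong_induction_on with
    | _ j ih =>
      intro k hk
      rcases lt_or_ge j 2 with hj | hj
      · exact h0 k (by omega)
      obtain ⟨j, rfl⟩ := Nat.exists_eq_add_of_le' hj
      rcases hk.lt_or_eq with hlt | heq
      · exact ih (j + 1) (by omega) k (by omega)
      set c := coeffZero k u with hc
      have hchom : c.IsHomogeneous (j + 1 + 1) := coeffZero_isHomogeneous hhom heq.symm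
      have hlap : ∑ a, pderiv a (pderiv a c) = 0 := by
        have h1 : lapB (m + 1) u = 0 := hu.2
        rw [lapB_apply, neg_eq_zero] at h1
        have h2 := congrArg (coeffZero k) h1
        rw [map_zero, Fin.sum_univ_succ, map_add, coeffZero_pderiv_zero, coeffZero_pderiv_zero,
          ih j (by omega) (k + 1 + 1) (by omega), smul_zero, smul_zero, zero_add, map_sum] at h2
        simpa only [coeffZero_pderiv_succ] using h2
      have hr : ∀ a b, X a * pderiv b c = X b * pderiv a c := by
        intro a b
        have := congrArg (coeffZero k) (hrot a b)
        rw [rot_apply, map_sub, coeffZero_X_succ_mul, coeffZero_X_succ_mul, coeffZero_pderiv_succ,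
          coeffZero_pderiv_succ, map_zero] at this
        exact sub_eq_zero.1 this
      refine eq_zero_of_pderiv_eq_zero hchom fun b => ?_
      have hbhom : (pderiv b c).IsHomogeneous (j + 1) := hchom.pderiv
      have h1 : ∑ a, pderiv a (X a * pderiv b c) = ((m : ℝ) + j + 1) • pderiv b c := by
        have := hbhom.sum_X_mul_pderiv
        simp only [pderiv_X_mul, if_true, Finset.sum_add_distrib, this, Finset.sum_const,
          Finset.card_univ, Fintype.card_fin]
        rw [← Nat.cast_smul_eq_nsmul ℝ, ← Nat.cast_smul_eq_nsmul ℝ]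
        push_cast
        module
      have h2 : ∑ a, pderiv a (X b * pderiv a c) = pderiv b c := by
        simp only [pderiv_X_mul, Finset.sum_add_distrib, ← Finset.mul_sum, hlap]
        simp
      simp only [hr] at h1
      rw [h2] at h1
      have hm : 1 ≤ m := b.pos
      have h3 : ((m : ℝ) + j) • pderiv b c = 0 := by
        have : ((m : ℝ) + j) • pderiv b c = ((m : ℝ) + j + 1) • pderiv b c - pderiv b c := by
          module
        rw [this, ← h1, sub_self]
      exact (smul_eq_zero.1 h3).resolve_left (by positivity)
  exact eq_zero_of_coeffZero fun k => key p k (by omega)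

/-- The coefficient of the `p`-th power of the zeroth variable. -/
def leadZero (p : ℕ) : MvPolynomial (Fin (m + 1)) ℝ →ₗ[ℝ] ℝ :=
  (aeval (R := ℝ) (fun _ : Fin m => (0 : ℝ))).toLinearMap ∘ₗ coeffZero p

theorem leadZero_apply (p : ℕ) (u : MvPolynomial (Fin (m + 1)) ℝ) :
    leadZero p u = constantCoeff (coeffZero p u) := by
  simp [leadZero, constantCoeff_eq]

theorem leadZero_rot_succ (p : ℕ) (a b : Fin m) (u : MvPolynomial (Fin (m + 1)) ℝ) :
    leadZero p (rot a.succ b.succ u) = 0 := by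
  rw [leadZero_apply, rot_apply, map_sub, coeffZero_X_succ_mul, coeffZero_X_succ_mul]
  simp

theorem leadZero_rot_zero (p : ℕ) (a : Fin m) (u : MvPolynomial (Fin (m + 1)) ℝ) :
    leadZero (p + 1) (rot a.succ 0 u) = - constantCoeff (pderiv a (coeffZero p u)) := by
  rw [leadZero_apply, rot_apply, map_sub, coeffZero_X_succ_mul, coeffZero_succ_X_zero_mul,
    coeffZero_pderiv_succ]
  simp

theorem exists_leadZero_ne {p : ℕ} {V : Submodule ℝ (MvPolynomial (Fin (m + 1)) ℝ)}
    (hV : V ≤ Hb (m + 1) p) (hrot : ∀ i j, ∀ v ∈ V, rot i j v ∈ V) (hne : V ≠ ⊥) :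
    ∃ v ∈ V, leadZero p v ≠ 0 := by
  by_contra! h
  have hhom : ∀ v ∈ V, v.IsHomogeneous p := fun v hv => (hV hv).1
  have key : ∀ j, ∀ k, p ≤ k + j → ∀ v ∈ V, coeffZero k v = 0 := by
    intro j
    induction j with
    | zero =>
      intro k hk v hv
      rcases hk.lt_or_eq with hlt | rfl
      · exact coeffZero_eq_zero (hhom v hv) hlt
      · exact eq_zero_of_isHomogeneous_zero (coeffZero_isHomogeneous (hhom v hv) rfl)
          (by rw [← leadZero_apply]; exact h v hv)
    | succ j ih =>
      intro k hk v hv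
      rcases hk.lt_or_eq with hlt | heq
      · exact ih k (by omega) v hv
      refine eq_zero_of_pderiv_eq_zero (coeffZero_isHomogeneous (hhom v hv) heq.symm) fun a => ?_
      have h1 := ih (k + 1) (by omega) _ (hrot a.succ 0 v hv)
      rw [rot_apply, map_sub, coeffZero_X_succ_mul, coeffZero_succ_X_zero_mul,
        coeffZero_pderiv_zero, ih (k + 1 + 1) (by omega) v hv, coeffZero_pderiv_succ] at h1
      simpa using h1
  exact hne ((Submodule.eq_bot_iff V).2 fun v hv =>
    eq_zero_of_coeffZero fun k => key p k (by omega) v hv)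

theorem isWeyl_pderiv : IsSuperWeyl (fun _ _ : Fin m => (1 : ℝ))
    (fun i => LinearMap.mulLeft ℝ (X i)) (fun i => (pderiv (R := ℝ) i).toLinearMap) where
  dx i j u := by
    rw [one_smul]
    exact pderiv_X_mul i j u
  dd i j u := by
    rw [one_smul]
    exact pderiv_comm i j u

/-- A rotation-stable space of harmonic polynomials contains a zonal harmonic. -/
theorem exists_zonal {p : ℕ} {V : Submodule ℝ (MvPolynomial (Fin (m + 1)) ℝ)}
    (hV : V ≤ Hb (m + 1) p) (hrot : ∀ i j, ∀ v ∈ V, rot i j v ∈ V) (hne : V ≠ ⊥) :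
    ∃ z ∈ V, leadZero p z ≠ 0 ∧ (∀ a b : Fin m, rot a.succ b.succ z = 0) ∧
      ∀ k, p = k + 1 → coeffZero k z = 0 := by
  let d : Fin (m + 1) → Module.End ℝ (MvPolynomial (Fin (m + 1)) ℝ) :=
    fun i => (pderiv (R := ℝ) i).toLinearMap
  let B := fischerForm d p
  have hG : ∀ k, ∀ u ∈ homogeneousSubmodule (Fin (m + 1)) ℝ (k + 1), ∀ i,
      d i u ∈ homogeneousSubmodule (Fin (m + 1)) ℝ k := fun k u hu i =>
    ((mem_homogeneousSubmodule _ _).1 hu).pderiv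
  have hadj := fischerForm_adjoint isWeyl_pderiv (G := homogeneousSubmodule (Fin (m + 1)) ℝ)
    (fun u hu i => pderiv_isHomogeneous_zero i hu) hG p
  have hVG : V ≤ homogeneousSubmodule (Fin (m + 1)) ℝ p := fun v hv => (hV hv).1
  have hdef : ∀ u ∈ V, B u u = 0 → u = 0 := fun u hu h =>
    fischerForm_definite hG (fun k u hu h => eq_zero_of_pderiv_eq_zero hu h) p u (hVG hu) h
  have hskew : ∀ i j, ∀ u ∈ V, ∀ w ∈ V, B (rot i j u) w = - B u (rot i j w) := by
    intro i j u hu w hw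
    have h1 := hadj i j u w (hVG hu) (hVG hw)
    have h2 := hadj j i u w (hVG hu) (hVG hw)
    change B (X i * pderiv j u) w = B u (X j * pderiv i w) at h1
    change B (X j * pderiv i u) w = B u (X i * pderiv j w) at h2
    rw [rot_apply, rot_apply, map_sub, map_sub, LinearMap.sub_apply, h1, h2, neg_sub]
  have : FiniteDimensional ℝ V := Submodule.finiteDimensional_of_le hVG
  obtain ⟨z, hz, hzφ⟩ := exists_bilin_representative B V hdef (leadZero p)
  obtain ⟨v, hv, hvp⟩ := exists_leadZero_ne hV hrot hne
  refine ⟨z, hz, fun h => hvp ?_, fun a b => ?_, ?_⟩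
  · rw [← hzφ z hz] at h
    rw [← hzφ v hv, hdef z hz h, map_zero, LinearMap.zero_apply]
  · refine hdef _ (hrot _ _ z hz) ?_
    rw [hskew _ _ z hz _ (hrot _ _ z hz), hzφ _ (hrot _ _ _ (hrot _ _ z hz)), leadZero_rot_succ,
      neg_zero]
  · rintro k rfl
    have hk := coeffZero_isHomogeneous (hV hz).1 (rfl : k + 1 = k + 1)
    refine eq_zero_of_pderiv_eq_zero (d := 0) hk fun a => ?_
    refine eq_zero_of_isHomogeneous_zero hk.pderiv ?_
    have h1 := hzφ _ (hrot a.succ 0 z hz)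
    rw [leadZero_rot_zero] at h1
    have h2 := hskew a.succ 0 z hz z hz
    have h3 : B (rot a.succ 0 z) z = B z (rot a.succ 0 z) := fischerForm_symm _ _ _ _
    linarith

/-- Two nonzero rotation-stable spaces of harmonic polynomials of the same degree intersect. -/
theorem rotation_stable_inf_ne_bot (hm : 1 ≤ m) {p : ℕ}
    {V W : Submodule ℝ (MvPolynomial (Fin m) ℝ)} (hV : V ≤ Hb m p) (hW : W ≤ Hb m p)
    (hVr : ∀ i j, ∀ v ∈ V, rot i j v ∈ V) (hWr : ∀ i j, ∀ v ∈ W, rot i j v ∈ W)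
    (hV0 : V ≠ ⊥) (hW0 : W ≠ ⊥) : ∃ v ∈ V, v ∈ W ∧ v ≠ 0 := by
  obtain ⟨m, rfl⟩ := Nat.exists_eq_add_of_le' hm
  obtain ⟨z, hz, hz0, hzr, hzk⟩ := exists_zonal hV hVr hV0
  obtain ⟨y, hy, hy0, hyr, hyk⟩ := exists_zonal hW hWr hW0
  have h : leadZero p y • z - leadZero p z • y = 0 := by
    have hmem : leadZero p y • z - leadZero p z • y ∈ Hb (m + 1) p :=
      sub_mem (Submodule.smul_mem _ _ (hV hz)) (Submodule.smul_mem _ _ (hW hy))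
    refine eq_zero_of_zonal hmem (fun a b => by simp [hzr, hyr]) fun k hk => ?_
    rcases hk.lt_or_eq with hlt | heq
    · rcases (Nat.lt_succ_iff.1 hlt).lt_or_eq with hlt | rfl
      · exact coeffZero_eq_zero hmem.1 hlt
      · refine eq_zero_of_isHomogeneous_zero (coeffZero_isHomogeneous hmem.1 rfl) ?_
        rw [← leadZero_apply, map_sub, map_smul, map_smul, smul_eq_mul, smul_eq_mul, mul_comm,
          sub_self]
    · rw [map_sub, map_smul, map_smul, hzk k heq, hyk k heq]
      simp
  refine ⟨leadZero p y • z, Submodule.smul_mem _ _ hz, ?_, fun h0 => ?_⟩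
  · rw [sub_eq_zero.1 h]
    exact Submodule.smul_mem _ _ hy
  · have := congrArg (leadZero p) h0
    rw [map_smul, map_zero] at this
    exact mul_ne_zero hy0 hz0 this

/-- The bosonic coefficients of the multiples of `w` contained in `U`. -/
def tmulSlice (U : Submodule ℝ (SuperPoly m n)) (w : Grass n) :
    Submodule ℝ (MvPolynomial (Fin m) ℝ) :=
  U.comap ((TensorProduct.mk ℝ (MvPolynomial (Fin m) ℝ) (Grass n)).flip w)

theorem mem_tmulSlice {U : Submodule ℝ (SuperPoly m n)} {w : Grass n}
    {v : MvPolynomial (Fin m) ℝ} : v ∈ tmulSlice U w ↔ v ⊗ₜ w ∈ U := Iff.rfl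

theorem LieStable.rot_mem_tmulSlice {U : Submodule ℝ (SuperPoly m n)} (hU : LieStable U)
    (w : Grass n) (i j : Fin m) {v : MvPolynomial (Fin m) ℝ} (hv : v ∈ tmulSlice U w) :
    rot i j v ∈ tmulSlice U w := by
  rw [mem_tmulSlice] at hv ⊢
  rw [rot_apply, TensorProduct.sub_tmul]
  exact hU.rotation i j _ hv

theorem exists_dual_ne_zero {w : Grass n} (hw : w ≠ 0) : ∃ φ : Grass n →ₗ[ℝ] ℝ, φ w ≠ 0 := by
  obtain ⟨φ, hφ, -⟩ := Submodule.exists_le_ker_of_notMem (p := (⊥ : Submodule ℝ (Grass n)))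
    (v := w) (by simpa using hw)
  exact ⟨φ, hφ⟩

theorem tmulSlice_le_Hb {p q : ℕ} {U : Submodule ℝ (SuperPoly m n)} (hU : U ≤ HbHf m n p q)
    {w : Grass n} (hw : w ≠ 0) : tmulSlice U w ≤ Hb m p := by
  obtain ⟨φ, hφ⟩ := exists_dual_ne_zero hw
  have hle : HbHf m n p q ≤ (Hb m p).comap
      ((TensorProduct.rid ℝ (MvPolynomial (Fin m) ℝ)).toLinearMap ∘ₗ φ.lTensor _) :=
    Submodule.map₂_le.2 fun v hv w _ => by
      simpa using Submodule.smul_mem _ (φ w) hv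
  intro v hv
  have h : φ w • v ∈ Hb m p := by simpa using hle (hU hv)
  exact (Submodule.smul_mem_iff _ hφ).1 h

theorem HbHf_le_fgrade (p q : ℕ) : HbHf m n p q ≤
    Submodule.map₂ (TensorProduct.mk ℝ _ _) (Hb m p) (fgrade n q) :=
  Submodule.map₂_le_map₂_right inf_le_left

theorem number_HbHf {p q : ℕ} {u : SuperPoly m n} (hu : u ∈ HbHf m n p q) :
    ∑ c, sx (m := m) (n := n) (.inr c) (sd (.inr c) u) = (q : ℝ) • u := by
  have hle : HbHf m n p q ≤ LinearMap.ker
      ((∑ c, sx (m := m) (n := n) (.inr c) * sd (.inr c)) - (q : ℝ) • 1) :=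
    Submodule.map₂_le.2 fun v hv w hw => by
      simp only [LinearMap.mem_ker, LinearMap.sub_apply, LinearMap.sum_apply, Module.End.mul_apply,
        LinearMap.smul_apply, Module.End.one_apply, TensorProduct.mk_apply, sub_eq_zero]
      rw [← TensorProduct.tmul_smul, ← number_fermion q w hw.1, TensorProduct.tmul_sum]
      rfl
  simpa [LinearMap.sum_apply, sub_eq_zero] using hle hu

theorem carE_HbHf {p q : ℕ} {u : SuperPoly m n} (hu : u ∈ HbHf m n p q) :
    ∑ j, sd (m := m) (n := n) (.inr (.inl j)) (sd (.inr (.inr j)) u) = 0 := by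
  have hle : HbHf m n p q ≤ LinearMap.ker
      (∑ j, sd (m := m) (n := n) (.inr (.inl j)) * sd (.inr (.inr j))) :=
    Submodule.map₂_le.2 fun v hv w hw => by
      have h1 : lapF n w = 0 := hw.2
      rw [lapF_eq, LinearMap.smul_apply, carE_apply] at h1
      have h2 := (smul_eq_zero.1 h1).resolve_left (by norm_num)
      simp only [LinearMap.mem_ker, LinearMap.sum_apply, Module.End.mul_apply]
      change ∑ j, v ⊗ₜ[ℝ] fd (.inl j) (fd (.inr j) w) = 0
      rw [← TensorProduct.tmul_sum, h2, TensorProduct.tmul_zero]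
  simpa [LinearMap.sum_apply] using hle hu

/-- Nonzero Lie-stable subspaces of `ℋ^b_p ⊗ ℋ^f_q` contain multiples of a common element of the
Grassmann algebra. -/
theorem exists_common_slice {q : ℕ} (hq : q ≤ n) (p : ℕ) : ∃ w : Grass n,
    ∀ U ≤ HbHf m n p q, LieStable U → U ≠ ⊥ → w ≠ 0 ∧ tmulSlice U w ≠ ⊥ := by
  obtain ⟨S, -, hS⟩ := Finset.exists_subset_card_eq
    (s := (Finset.univ : Finset (Fin n))) (n := q) (by simpa using hq)
  obtain ⟨w, hw⟩ := exists_eq_tmul_of_sx_eq_zero (m := m) p S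
  refine ⟨w, fun U hU hL hne => ?_⟩
  obtain ⟨u, hu, hu0, huS⟩ := isCAR_super.exists_saturated hL.sp (by simpa using hq)
    (fun u hu => number_HbHf (hU hu)) (fun u hu => carE_HbHf (hU hu)) hne S hS.le
  obtain ⟨v, rfl⟩ := hw u (hS ▸ HbHf_le_fgrade p q (hU hu)) fun i hi => (huS i hi).1
  refine ⟨fun h => hu0 (by rw [h, TensorProduct.tmul_zero]), (Submodule.ne_bot_iff _).2 ⟨v, hu, ?_⟩⟩
  rintro rfl
  exact hu0 (TensorProduct.zero_tmul _ _)

theorem HbHf_irreducible (hm : 1 ≤ m) {q : ℕ} (hq : q ≤ n) (p : ℕ)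
    {U : Submodule ℝ (SuperPoly m n)} (hU : U ≤ HbHf m n p q) (hA : ActStable U) :
    U = ⊥ ∨ U = HbHf m n p q := by
  by_contra! h
  obtain ⟨h0, h1⟩ := h
  have hVP : HbHf m n p q ≤ P m n (p + q) := HbHf_le_P rfl
  set W := fischerCompl (p + q) U (HbHf m n p q)
  have hWV : W ≤ HbHf m n p q := fun w hw => hw.1
  have hWL : LieStable W :=
    fischerCompl_lieStable hA.lieStable (HbHf_actStable p q).lieStable hU hVP
  obtain ⟨w, hw⟩ := exists_common_slice (m := m) hq p
  obtain ⟨hw0, hUs⟩ := hw U hU hA.lieStable h0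
  obtain ⟨-, hWs⟩ := hw W hWV hWL (fischerCompl_ne_bot hU h1 hVP)
  obtain ⟨v, hvU, hvW, hv0⟩ := rotation_stable_inf_ne_bot hm (tmulSlice_le_Hb hU hw0)
    (tmulSlice_le_Hb hWV hw0) (fun i j v hv => hA.lieStable.rot_mem_tmulSlice w i j hv)
    (fun i j v hv => hWL.rot_mem_tmulSlice w i j hv) hUs hWs
  have h2 : v ⊗ₜ[ℝ] w = 0 := fischer_definite (hVP (hU hvU)) (hvW.2 _ hvU)
  obtain ⟨φ, hφ⟩ := exists_dual_ne_zero hw0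
  have h3 := congrArg
    ((TensorProduct.rid ℝ (MvPolynomial (Fin m) ℝ)).toLinearMap ∘ₗ φ.lTensor _) h2
  exact smul_ne_zero hφ hv0 (by simpa using h3)

theorem map_fkpq_irreducible (hm : 1 ≤ m) {q : ℕ} (hq : q ≤ n) (p l p' q' : ℕ)
    {U : Submodule ℝ (SuperPoly m n)}
    (hU : U ≤ (HbHf m n p q).map (LinearMap.mulLeft ℝ (fkpq m n l p' q'))) (hA : ActStable U) :
    U = ⊥ ∨ U = (HbHf m n p q).map (LinearMap.mulLeft ℝ (fkpq m n l p' q')) := by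
  set f := LinearMap.mulLeft ℝ (fkpq m n l p' q') with hf
  have hmap : (U.comap f ⊓ HbHf m n p q).map f = U := by
    refine le_antisymm (Submodule.map_le_iff_le_comap.2 inf_le_left) fun u hu => ?_
    obtain ⟨v, hv, rfl⟩ := hU hu
    exact ⟨v, ⟨hu, hv⟩, rfl⟩
  have hst : ActStable (U.comap f ⊓ HbHf m n p q) := by
    rintro A D hA' hD _ ⟨u, hu, rfl⟩
    refine ⟨?_, act_mem_HbHf hA' hD hu.2⟩
    have := hA.act_mem hA' hD hu.1
    rwa [hf, LinearMap.mulLeft_apply, map_mul, act_fkpq hA' hD] at this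
  rcases HbHf_irreducible hm hq p inf_le_right hst with h | h
  · exact .inl (by rw [← hmap, h, Submodule.map_bot])
  · exact .inr (by rw [← hmap, h])

theorem decompPiece_irreducible (hm : 1 ≤ m) (k : ℕ) (idx : decompIdx n k)
    {U : Submodule ℝ (SuperPoly m n)} (hU : U ≤ decompPiece m n k idx) (hA : ActStable U) :
    U = ⊥ ∨ U = decompPiece m n k idx := by
  rcases idx with i | ⟨j, l⟩
  · exact HbHf_irreducible hm (by have := i.2; omega) _ hU hA
  · exact map_fkpq_irreducible hm (by have := j.2; omega) _ _ _ _ hU hA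

end harmonics

/-- decomposition of ℋ_k under SO(m) × Sp(2n):
ℋ_k = ⊕_{i=0}^{min(n,k)} ℋ^b_{k−i}·ℋ^f_i ⊕
⊕_{j=0}^{min(n,k−1)−1} ⊕_{l=1}^{min(n−j,⌊(k−j)/2⌋)} f_{l,k−2l−j,j}·(ℋ^b_{k−2l−j}·ℋ^f_j)
(an internal direct sum), each summand is invariant under the action of SO(m)×Sp(2n),
and each summand is irreducible (its only invariant subspaces are 0 and itself). -/
theorem H_decomposition (m n : ℕ) (hm : 1 ≤ m) (hn : 1 ≤ n) (k : ℕ) :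
    (H m n k = ⨆ idx : decompIdx n k, decompPiece m n k idx) ∧
    iSupIndep (decompPiece m n k) ∧
    (∀ idx : decompIdx n k, ∀ A D, isSO m A → isSp n D →
      Submodule.map (act m n A D).toLinearMap (decompPiece m n k idx) ≤ decompPiece m n k idx) ∧
    (∀ idx : decompIdx n k, ∀ U : Submodule ℝ (SuperPoly m n), U ≤ decompPiece m n k idx →
      (∀ A D, isSO m A → isSp n D → Submodule.map (act m n A D).toLinearMap U ≤ U) →
      U = ⊥ ∨ U = decompPiece m n k idx) := by
  exact ⟨H_eq_iSup hm hn k, iSupIndep_decompPiece hm k,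
    fun idx A D hA hD => act_decompPiece_le k idx hA hD,
    fun idx U hU hA => decompPiece_irreducible hm k idx hU hA⟩

end
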